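/- arXiv:2501.01627 — 3 statements merged into one kernel-verified Lean document; each statement's English description precedes it below -/
import Mathlib

section
/- (M. Riesz) Let 1 < p < ∞. If u is a real-valued harmonic function in the unit disk 𝔻 belonging to h^p, and v is its harmonic conjugate normalized by v(0) = 0, then v ∈ h^p; moreover, there exists a constant A_p depending only on p such that M_p(r,v) ≤ A_p · M_p(r,u) for all 0 < r < 1 and all u ∈ h^p. -/
open Complex Real Set

noncomputable section

/-- The open unit disk in the complex plane. -/
def unitDisk : Set ℂ := Metric.ball 0 1

/-- The integral mean `M_p(r, u)` of a real-valued function `u`. -/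
def circleMeanR (p : ℝ) (u : ℂ → ℝ) (r : ℝ) : ℝ :=
  ((1 / (2 * π)) *
    ∫ θ in (0:ℝ)..(2 * π), |u (r * Complex.exp (θ * Complex.I))| ^ p) ^ (1 / p)

/-- Membership in the harmonic Hardy space `h^p` for real-valued functions. -/
def InHardyR (p : ℝ) (u : ℂ → ℝ) : Prop :=
  ∃ C : ℝ, ∀ r : ℝ, 0 < r → r < 1 → circleMeanR p u r ≤ C

/-- Differentiation under the integral sign for jointly continuous integrands. -/
theorem hasDerivAt_integral_of_continuousOn {f f' : ℝ → ℝ → ℝ} {s : Set ℝ} (hs : IsOpen s)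
    (hf : ContinuousOn (fun q : ℝ × ℝ => f q.1 q.2) (s ×ˢ univ))
    (hf' : ContinuousOn (fun q : ℝ × ℝ => f' q.1 q.2) (s ×ˢ univ))
    (hd : ∀ x ∈ s, ∀ t, HasDerivAt (fun x => f x t) (f' x t) x) {x₀ : ℝ} (hx₀ : x₀ ∈ s)
    (a b : ℝ) :
    HasDerivAt (fun x => ∫ t in a..b, f x t) (∫ t in a..b, f' x₀ t) x₀ := by
  have slice : ∀ {g : ℝ → ℝ → ℝ}, ContinuousOn (fun q : ℝ × ℝ => g q.1 q.2) (s ×ˢ univ) →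
      ∀ x ∈ s, Continuous (g x) := fun {g} hg x hx =>
    hg.comp_continuous (f := fun t => (x, t)) (by fun_prop) (fun t => ⟨hx, mem_univ _⟩)
  obtain ⟨δ, hδ, hball⟩ := Metric.nhds_basis_closedBall.mem_iff.1 (hs.mem_nhds hx₀)
  obtain ⟨C, hC⟩ := ((isCompact_closedBall x₀ δ).prod (isCompact_uIcc (a := a) (b := b))
    ).exists_bound_of_continuousOn (hf'.mono (prod_mono hball (subset_univ _)))
  refine (intervalIntegral.hasDerivAt_integral_of_dominated_loc_of_deriv_le
    (F' := f') (bound := fun _ => C) (Metric.closedBall_mem_nhds x₀ hδ) ?_ ?_ ?_ ?_ ?_ ?_).2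
  · filter_upwards [hs.mem_nhds hx₀] with x hx
    exact (slice hf x hx).aestronglyMeasurable
  · exact (slice hf x₀ hx₀).intervalIntegrable _ _
  · exact (slice hf' x₀ hx₀).aestronglyMeasurable
  · exact .of_forall fun t ht x hx => hC (x, t) ⟨hx, uIoc_subset_uIcc ht⟩
  · exact intervalIntegrable_const
  · exact .of_forall fun t _ x hx => hd x (hball hx) t

section SubMean

variable {Φ : ℂ → ℝ} {F : ℂ → ℂ} {U : Set ℂ} {γ α : ℝ → ℂ} {γ' α' : ℂ} {t : ℝ}

theorem hasDerivAt_comp_curve (hF : DifferentiableAt ℂ F (γ t)) (hγ : HasDerivAt γ γ' t) :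
    HasDerivAt (fun t => F (γ t)) (deriv F (γ t) * γ') t := by
  simpa [Function.comp_def, mul_comm] using! (hF.hasDerivAt.hasFDerivAt.restrictScalars ℝ).comp_hasDerivAt t hγ

theorem hasDerivAt_real_comp_curve (hΦ : ContDiff ℝ 2 Φ) (hF : DifferentiableAt ℂ F (γ t))
    (hγ : HasDerivAt γ γ' t) :
    HasDerivAt (fun t => Φ (F (γ t))) (fderiv ℝ Φ (F (γ t)) (deriv F (γ t) * γ')) t :=
  ((hΦ.differentiable (by norm_num)) (F (γ t))).hasFDerivAt.comp_hasDerivAt t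
    (hasDerivAt_comp_curve hF hγ)

theorem hasDerivAt_fderiv_comp_curve (hΦ : ContDiff ℝ 2 Φ) (hF : DifferentiableAt ℂ F (γ t))
    (hF' : DifferentiableAt ℂ (deriv F) (γ t))
    (hγ : HasDerivAt γ γ' t) (hα : HasDerivAt α α' t) :
    HasDerivAt (fun t => fderiv ℝ Φ (F (γ t)) (deriv F (γ t) * α t))
      (fderiv ℝ (fderiv ℝ Φ) (F (γ t)) (deriv F (γ t) * γ') (deriv F (γ t) * α t) +
        fderiv ℝ Φ (F (γ t)) (deriv (deriv F) (γ t) * γ' * α t + deriv F (γ t) * α')) t := by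
  have h1 : Differentiable ℝ (fderiv ℝ Φ) :=
    (hΦ.fderiv_right (m := 1) (by norm_num)).differentiable (by norm_num)
  have h2 := (h1 (F (γ t))).hasFDerivAt.comp_hasDerivAt t (hasDerivAt_comp_curve hF hγ)
  exact h2.clm_apply ((hasDerivAt_comp_curve hF' hγ).mul hα)

/-- The sub-mean value property of `Φ ∘ F` on circles centred at the origin, where `Φ` is a
subharmonic function of class `C²` and `F` is holomorphic in the unit disk. -/
theorem le_integral_comp_of_subharmonic (hΦ : ContDiff ℝ 2 Φ)
    (hsub : ∀ w a : ℂ, 0 ≤ fderiv ℝ (fderiv ℝ Φ) w a a +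
      fderiv ℝ (fderiv ℝ Φ) w (a * I) (a * I))
    (hF : DifferentiableOn ℂ F (Metric.ball 0 1)) {r : ℝ} (hr0 : 0 < r) (hr1 : r < 1) :
    2 * π * Φ (F 0) ≤ ∫ θ in (0 : ℝ)..(2 * π), Φ (F (r * exp (θ * I))) := by
  have hB : IsOpen (Metric.ball (0 : ℂ) 1) := Metric.isOpen_ball
  have hF1 : DifferentiableOn ℂ (deriv F) (Metric.ball 0 1) := hF.deriv hB
  have hF2 : DifferentiableOn ℂ (deriv (deriv F)) (Metric.ball 0 1) := hF1.deriv hB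
  set s : Set ℝ := Ioo (-1) 1 with hs
  have hmem : ∀ ρ ∈ s, ∀ θ : ℝ, (ρ * exp (θ * I) : ℂ) ∈ Metric.ball (0 : ℂ) 1 := by
    intro ρ hρ θ
    simpa [Complex.norm_exp_ofReal_mul_I, abs_lt, hs] using hρ
  have hdat : ∀ {H : ℂ → ℂ}, DifferentiableOn ℂ H (Metric.ball 0 1) → ∀ ρ ∈ s, ∀ θ : ℝ,
      DifferentiableAt ℂ H (ρ * exp (θ * I)) := fun hH ρ hρ θ =>
    hH.differentiableAt (hB.mem_nhds (hmem ρ hρ θ))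
  have hcont : ∀ {H : ℂ → ℂ}, DifferentiableOn ℂ H (Metric.ball 0 1) →
      ContinuousOn (fun q : ℝ × ℝ => H (q.1 * exp (q.2 * I))) (s ×ˢ univ) := fun hH =>
    hH.continuousOn.comp (by fun_prop) (fun q hq => hmem q.1 hq.1 q.2)
  have hD1 : Continuous (fderiv ℝ Φ) := hΦ.continuous_fderiv (by norm_num)
  have hD2 : Continuous (fderiv ℝ (fderiv ℝ Φ)) :=
    (hΦ.fderiv_right (m := 1) (by norm_num)).continuous_fderiv (by norm_num)
  have hdρ : ∀ ρ θ : ℝ, HasDerivAt (fun ρ : ℝ => (ρ * exp (θ * I) : ℂ)) (exp (θ * I)) ρ := by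
    intro ρ θ
    simpa using (Complex.ofRealCLM.hasDerivAt (x := ρ)).mul_const (exp (θ * I))
  have hdθ : ∀ ρ θ : ℝ, HasDerivAt (fun θ : ℝ => (ρ * exp (θ * I) : ℂ))
      (ρ * exp (θ * I) * I) θ := by
    intro ρ θ
    have := (((Complex.ofRealCLM.hasDerivAt (x := θ)).mul_const I).cexp).const_mul (ρ : ℂ)
    simpa [mul_assoc] using this
  let f₀ : ℝ → ℝ → ℝ := fun ρ θ => Φ (F (ρ * exp (θ * I)))
  let f₁ : ℝ → ℝ → ℝ := fun ρ θ => fderiv ℝ Φ (F (ρ * exp (θ * I)))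
    (deriv F (ρ * exp (θ * I)) * exp (θ * I))
  let f₂ : ℝ → ℝ → ℝ := fun ρ θ =>
    fderiv ℝ (fderiv ℝ Φ) (F (ρ * exp (θ * I))) (deriv F (ρ * exp (θ * I)) * exp (θ * I))
      (deriv F (ρ * exp (θ * I)) * exp (θ * I)) +
    fderiv ℝ Φ (F (ρ * exp (θ * I))) (deriv (deriv F) (ρ * exp (θ * I)) * exp (θ * I) *
      exp (θ * I) + deriv F (ρ * exp (θ * I)) * 0)
  let g₁ : ℝ → ℝ → ℝ := fun ρ θ => fderiv ℝ Φ (F (ρ * exp (θ * I)))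
    (deriv F (ρ * exp (θ * I)) * (ρ * exp (θ * I) * I))
  let g₂ : ℝ → ℝ → ℝ := fun ρ θ =>
    fderiv ℝ (fderiv ℝ Φ) (F (ρ * exp (θ * I)))
      (deriv F (ρ * exp (θ * I)) * (ρ * exp (θ * I) * I))
      (deriv F (ρ * exp (θ * I)) * (ρ * exp (θ * I) * I)) +
    fderiv ℝ Φ (F (ρ * exp (θ * I))) (deriv (deriv F) (ρ * exp (θ * I)) *
      (ρ * exp (θ * I) * I) * (ρ * exp (θ * I) * I) +
      deriv F (ρ * exp (θ * I)) * (ρ * exp (θ * I) * I * I))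
  have hc := hcont hF
  have hc1 := hcont hF1
  have hc2 := hcont hF2
  have hcΦ := hD1.comp_continuousOn hc
  have hcΦ2 := hD2.comp_continuousOn hc
  have he : ContinuousOn (fun q : ℝ × ℝ => exp (q.2 * I)) (s ×ˢ univ) := by fun_prop
  have hz : ContinuousOn (fun q : ℝ × ℝ => (q.1 * exp (q.2 * I) * I : ℂ)) (s ×ˢ univ) := by
    fun_prop
  have hf₀ : ContinuousOn (fun q : ℝ × ℝ => f₀ q.1 q.2) (s ×ˢ univ) :=
    hΦ.continuous.comp_continuousOn hc
  have hf₁ : ContinuousOn (fun q : ℝ × ℝ => f₁ q.1 q.2) (s ×ˢ univ) :=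
    hcΦ.clm_apply (hc1.mul he)
  have hf₂ : ContinuousOn (fun q : ℝ × ℝ => f₂ q.1 q.2) (s ×ˢ univ) :=
    ((hcΦ2.clm_apply (hc1.mul he)).clm_apply (hc1.mul he)).add
      (hcΦ.clm_apply (((hc2.mul he).mul he).add (hc1.mul continuousOn_const)))
  have hg₂ : ContinuousOn (fun q : ℝ × ℝ => g₂ q.1 q.2) (s ×ˢ univ) :=
    ((hcΦ2.clm_apply (hc1.mul hz)).clm_apply (hc1.mul hz)).add
      (hcΦ.clm_apply (((hc2.mul hz).mul hz).add (hc1.mul (hz.mul continuousOn_const))))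
  have slice : ∀ {g : ℝ → ℝ → ℝ}, ContinuousOn (fun q : ℝ × ℝ => g q.1 q.2) (s ×ˢ univ) →
      ∀ x ∈ s, IntervalIntegrable (g x) MeasureTheory.volume 0 (2 * π) := fun {g} hg x hx =>
    (hg.comp_continuous (f := fun t => (x, t)) (by fun_prop)
      (fun t => ⟨hx, mem_univ _⟩)).intervalIntegrable _ _
  have hso : IsOpen s := isOpen_Ioo
  have hM : ∀ ρ ∈ s, HasDerivAt (fun ρ => ∫ θ in (0 : ℝ)..(2 * π), f₀ ρ θ)
      (∫ θ in (0 : ℝ)..(2 * π), f₁ ρ θ) ρ := fun ρ hρ =>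
    hasDerivAt_integral_of_continuousOn hso hf₀ hf₁ (fun x hx t =>
      hasDerivAt_real_comp_curve hΦ (hdat hF x hx t) (hdρ x t)) hρ _ _
  have hM1 : ∀ ρ ∈ s, HasDerivAt (fun ρ => ∫ θ in (0 : ℝ)..(2 * π), f₁ ρ θ)
      (∫ θ in (0 : ℝ)..(2 * π), f₂ ρ θ) ρ := fun ρ hρ =>
    hasDerivAt_integral_of_continuousOn hso hf₁ hf₂ (fun x hx t =>
      hasDerivAt_fderiv_comp_curve hΦ (hdat hF x hx t) (hdat hF1 x hx t) (hdρ x t)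
        (hasDerivAt_const x _)) hρ _ _
  have hg₂int : ∀ ρ ∈ s, ∫ θ in (0 : ℝ)..(2 * π), g₂ ρ θ = 0 := by
    intro ρ hρ
    rw [intervalIntegral.integral_eq_sub_of_hasDerivAt (f := g₁ ρ) (fun θ _ => ?_)
      (slice hg₂ ρ hρ)]
    · simp [g₁]
    · exact hasDerivAt_fderiv_comp_curve hΦ (hdat hF ρ hρ θ) (hdat hF1 ρ hρ θ) (hdθ ρ θ)
        ((hdθ ρ θ).mul_const I)
  have hpt : ∀ ρ θ : ℝ, 0 ≤ ρ * f₁ ρ θ + ρ ^ 2 * f₂ ρ θ + g₂ ρ θ := by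
    intro ρ θ
    set D := fderiv ℝ Φ (F (ρ * exp (θ * I)))
    set Q := fderiv ℝ (fderiv ℝ Φ) (F (ρ * exp (θ * I)))
    set a := deriv F (ρ * exp (θ * I))
    set b := deriv (deriv F) (ρ * exp (θ * I))
    set e := exp (θ * I)
    have e1 : ρ * D (a * e) = D (a * (ρ * e)) := by
      rw [← smul_eq_mul, ← map_smul]; congr 1; rw [real_smul]; ring
    have e2 : ρ ^ 2 * Q (a * e) (a * e) = Q (a * (ρ * e)) (a * (ρ * e)) := by
      have : a * (ρ * e) = ρ • (a * e) := by rw [real_smul]; ring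
      rw [this]
      simp only [map_smul, smul_apply, smul_eq_mul]
      ring
    have e3 : ρ ^ 2 * D (b * e * e + a * 0) = D (b * (ρ * e) * (ρ * e)) := by
      rw [← smul_eq_mul, ← map_smul]; congr 1; rw [real_smul]; push_cast; ring
    have e4 : D (b * (ρ * e * I) * (ρ * e * I) + a * (ρ * e * I * I)) =
        - D (b * (ρ * e) * (ρ * e)) - D (a * (ρ * e)) := by
      rw [← map_neg, ← map_sub]; congr 1
      linear_combination (b * (ρ * e) * (ρ * e) + a * (ρ * e)) * I_mul_I
    have e5 := hsub (F (ρ * exp (θ * I))) (a * (ρ * e))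
    rw [mul_assoc a] at e5
    change 0 ≤ ρ * D (a * e) + ρ ^ 2 * (Q (a * e) (a * e) + D (b * e * e + a * 0)) +
      (Q (a * (ρ * e * I)) (a * (ρ * e * I)) +
        D (b * (ρ * e * I) * (ρ * e * I) + a * (ρ * e * I * I)))
    rw [mul_add, e1, e2, e3, e4]
    linarith
  have hIco : ∀ ρ ∈ Ico (0 : ℝ) 1, ρ ∈ s := fun ρ hρ => ⟨by linarith [hρ.1], hρ.2⟩
  have hN : ∀ ρ ∈ s, HasDerivAt (fun ρ => ρ * ∫ θ in (0 : ℝ)..(2 * π), f₁ ρ θ)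
      (1 * (∫ θ in (0 : ℝ)..(2 * π), f₁ ρ θ) + ρ * ∫ θ in (0 : ℝ)..(2 * π), f₂ ρ θ) ρ :=
    fun ρ hρ => (hasDerivAt_id ρ).mul (hM1 ρ hρ)
  have hN' : ∀ ρ ∈ Ioo (0 : ℝ) 1,
      0 ≤ 1 * (∫ θ in (0 : ℝ)..(2 * π), f₁ ρ θ) + ρ * ∫ θ in (0 : ℝ)..(2 * π), f₂ ρ θ := by
    intro ρ hρ
    have hρs := hIco ρ ⟨hρ.1.le, hρ.2⟩
    have i1 := slice hf₁ ρ hρs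
    have i2 := slice hf₂ ρ hρs
    have i3 := slice hg₂ ρ hρs
    have h := intervalIntegral.integral_nonneg (μ := MeasureTheory.volume)
      (by positivity : (0 : ℝ) ≤ 2 * π) (fun θ _ => hpt ρ θ)
    rw [intervalIntegral.integral_add ((i1.const_mul _).add (i2.const_mul _)) i3,
      intervalIntegral.integral_add (i1.const_mul _) (i2.const_mul _),
      intervalIntegral.integral_const_mul, intervalIntegral.integral_const_mul,
      hg₂int ρ hρs] at h
    refine nonneg_of_mul_nonneg_right (a := ρ) ?_ hρ.1
    linarith
  have hNmono : MonotoneOn (fun ρ => ρ * ∫ θ in (0 : ℝ)..(2 * π), f₁ ρ θ) (Ico 0 1) := by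
    refine monotoneOn_of_hasDerivWithinAt_nonneg (convex_Ico 0 1)
      (fun ρ hρ => (hN ρ (hIco ρ hρ)).continuousAt.continuousWithinAt)
      (fun ρ hρ => (hN ρ (hIco ρ (interior_subset hρ))).hasDerivWithinAt) ?_
    rw [interior_Ico]
    exact hN'
  have hMmono : MonotoneOn (fun ρ => ∫ θ in (0 : ℝ)..(2 * π), f₀ ρ θ) (Ico 0 1) := by
    refine monotoneOn_of_hasDerivWithinAt_nonneg (convex_Ico 0 1)
      (fun ρ hρ => (hM ρ (hIco ρ hρ)).continuousAt.continuousWithinAt)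
      (fun ρ hρ => (hM ρ (hIco ρ (interior_subset hρ))).hasDerivWithinAt) ?_
    rw [interior_Ico]
    intro ρ hρ
    have := hNmono ⟨le_rfl, one_pos⟩ ⟨hρ.1.le, hρ.2⟩ hρ.1.le
    simp only [zero_mul] at this
    exact nonneg_of_mul_nonneg_right this hρ.1
  simpa [f₀] using hMmono ⟨le_rfl, one_pos⟩ ⟨hr0.le, hr1⟩ hr0.le

end SubMean

section TestFunctions

/-- Computes the second derivative of a `C²` function along a line. -/
theorem fderiv_fderiv_apply_eq {Φ : ℂ → ℝ} (hΦ : ContDiff ℝ 2 Φ) {w a : ℂ} {d₁ : ℝ → ℝ} {d₂ : ℝ}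
    (h₁ : ∀ t : ℝ, HasDerivAt (fun t : ℝ => Φ (w + t * a)) (d₁ t) t) (h₂ : HasDerivAt d₁ d₂ 0) :
    fderiv ℝ (fderiv ℝ Φ) w a a = d₂ := by
  have hline : ∀ t : ℝ, HasDerivAt (fun t : ℝ => w + t * a) a t := fun t => by
    simpa using ((Complex.ofRealCLM.hasDerivAt (x := t)).mul_const a).const_add w
  have hd : ∀ t : ℝ, d₁ t = fderiv ℝ Φ (w + t * a) a := fun t =>
    (h₁ t).unique (((hΦ.differentiable (by norm_num)) _).hasFDerivAt.comp_hasDerivAt t (hline t))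
  have hD : Differentiable ℝ (fderiv ℝ Φ) :=
    (hΦ.fderiv_right (m := 1) (by norm_num)).differentiable (by norm_num)
  have h : HasDerivAt (fun t : ℝ => fderiv ℝ Φ (w + t * a))
      (fderiv ℝ (fderiv ℝ Φ) (w + (0 : ℝ) * a) a) 0 :=
    (hD (w + (0 : ℝ) * a)).hasFDerivAt.comp_hasDerivAt 0 (hline 0)
  have h' : HasDerivAt d₁ (fderiv ℝ (fderiv ℝ Φ) (w + (0 : ℝ) * a) a a) 0 := by
    rw [funext hd]
    exact ((ContinuousLinearMap.apply ℝ ℝ a).hasFDerivAt).comp_hasDerivAt 0 h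
  rw [ofReal_zero, zero_mul, add_zero] at h'
  exact h'.unique h₂

variable {ε q : ℝ}

theorem hasDerivAt_re_line (w a : ℂ) (t : ℝ) :
    HasDerivAt (fun t : ℝ => (w + t * a).re) a.re t := by
  simpa using ((hasDerivAt_id t).mul_const a.re).const_add w.re

theorem hasDerivAt_im_line (w a : ℂ) (t : ℝ) :
    HasDerivAt (fun t : ℝ => (w + t * a).im) a.im t := by
  simpa using ((hasDerivAt_id t).mul_const a.im).const_add w.im

/-- For `1/2 < q ≤ 1`, a regularisation of `C |Re z| ^ (2 q) - |z| ^ (2 q)`. -/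
def lowTest (C ε q : ℝ) (z : ℂ) : ℝ :=
  C * (z.re ^ 2 + ε) ^ q - (z.re ^ 2 + z.im ^ 2 + ε) ^ q

/-- For `1 ≤ q`, a regularisation of `K (Re z)² |z| ^ (2 q - 2) - |z| ^ (2 q)`. -/
def highTest (K ε q : ℝ) (z : ℂ) : ℝ :=
  (K * z.re ^ 2 - (z.re ^ 2 + z.im ^ 2 + ε)) * (z.re ^ 2 + z.im ^ 2 + ε) ^ (q - 1)

theorem contDiff_re_sq_add : ContDiff ℝ 2 (fun z : ℂ => z.re ^ 2 + ε) :=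
  (Complex.reCLM.contDiff.pow 2).add contDiff_const

theorem contDiff_re_sq_add_im_sq_add : ContDiff ℝ 2 (fun z : ℂ => z.re ^ 2 + z.im ^ 2 + ε) :=
  ((Complex.reCLM.contDiff.pow 2).add (Complex.imCLM.contDiff.pow 2)).add contDiff_const

theorem contDiff_lowTest (C : ℝ) (hε : 0 < ε) : ContDiff ℝ 2 (lowTest C ε q) :=
  (contDiff_const.mul (contDiff_re_sq_add.rpow_const_of_ne fun z => by positivity)).sub
    (contDiff_re_sq_add_im_sq_add.rpow_const_of_ne fun z => by positivity)

theorem contDiff_highTest (K : ℝ) (hε : 0 < ε) : ContDiff ℝ 2 (highTest K ε q) :=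
  ((contDiff_const.mul (Complex.reCLM.contDiff.pow 2)).sub contDiff_re_sq_add_im_sq_add).mul
    (contDiff_re_sq_add_im_sq_add.rpow_const_of_ne fun z => by positivity)

/-- First and second derivatives of a real power of a positive function. -/
theorem hasDerivAt_rpow_of_pos {f f' : ℝ → ℝ} {f'' : ℝ} (hpos : ∀ t, 0 < f t)
    (hf : ∀ t, HasDerivAt f (f' t) t) (hf' : HasDerivAt f' f'' 0) (m : ℝ) :
    (∀ t, HasDerivAt (fun t => f t ^ m) (f' t * m * f t ^ (m - 1)) t) ∧
      HasDerivAt (fun t => f' t * m * f t ^ (m - 1))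
        (m * f'' * f 0 ^ (m - 1) + m * (m - 1) * f' 0 ^ 2 * f 0 ^ (m - 2)) 0 := by
  refine ⟨fun t => (hf t).rpow_const (Or.inl (hpos t).ne'), ?_⟩
  refine ((hf'.mul_const m).mul
    ((hf 0).rpow_const (p := m - 1) (Or.inl (hpos 0).ne'))).congr_deriv ?_
  rw [show m - 1 - 1 = m - 2 by ring]
  ring

theorem hasDerivAt_re_sq_line (w a : ℂ) (c : ℝ) :
    (∀ t : ℝ, HasDerivAt (fun t : ℝ => (w + t * a).re ^ 2 + c) (2 * (w + t * a).re * a.re) t) ∧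
      HasDerivAt (fun t : ℝ => 2 * (w + t * a).re * a.re) (2 * a.re ^ 2) 0 := by
  refine ⟨fun t => ?_, ?_⟩
  · simpa using ((hasDerivAt_re_line w a t).pow 2).add_const c
  · refine (((hasDerivAt_re_line w a 0).const_mul 2).mul_const a.re).congr_deriv ?_
    ring

theorem hasDerivAt_normSq_line (w a : ℂ) (c : ℝ) :
    (∀ t : ℝ, HasDerivAt (fun t : ℝ => (w + t * a).re ^ 2 + (w + t * a).im ^ 2 + c)
        (2 * (w + t * a).re * a.re + 2 * (w + t * a).im * a.im) t) ∧
      HasDerivAt (fun t : ℝ => 2 * (w + t * a).re * a.re + 2 * (w + t * a).im * a.im)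
        (2 * a.re ^ 2 + 2 * a.im ^ 2) 0 := by
  refine ⟨fun t => ?_, ?_⟩
  · simpa using (((hasDerivAt_re_line w a t).pow 2).add
      ((hasDerivAt_im_line w a t).pow 2)).add_const c
  · refine ((((hasDerivAt_re_line w a 0).const_mul 2).mul_const a.re).add
      (((hasDerivAt_im_line w a 0).const_mul 2).mul_const a.im)).congr_deriv ?_
    ring

theorem fderiv_fderiv_lowTest (C : ℝ) (hε : 0 < ε) (w a : ℂ) :
    fderiv ℝ (fderiv ℝ (lowTest C ε q)) w a a =
      C * (q * (2 * a.re ^ 2) * (w.re ^ 2 + ε) ^ (q - 1) +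
        q * (q - 1) * (2 * w.re * a.re) ^ 2 * (w.re ^ 2 + ε) ^ (q - 2)) -
      (q * (2 * a.re ^ 2 + 2 * a.im ^ 2) * (w.re ^ 2 + w.im ^ 2 + ε) ^ (q - 1) +
        q * (q - 1) * (2 * w.re * a.re + 2 * w.im * a.im) ^ 2 *
          (w.re ^ 2 + w.im ^ 2 + ε) ^ (q - 2)) := by
  obtain ⟨h1, h2⟩ := hasDerivAt_rpow_of_pos (fun t => by positivity)
    (hasDerivAt_re_sq_line w a ε).1 (hasDerivAt_re_sq_line w a ε).2 q
  obtain ⟨h3, h4⟩ := hasDerivAt_rpow_of_pos (fun t => by positivity)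
    (hasDerivAt_normSq_line w a ε).1 (hasDerivAt_normSq_line w a ε).2 q
  refine fderiv_fderiv_apply_eq (contDiff_lowTest C hε)
    (fun t => ((h1 t).const_mul C).sub (h3 t)) ?_
  simpa using! (h2.const_mul C).sub h4

theorem fderiv_fderiv_highTest (K : ℝ) (hε : 0 < ε) (w a : ℂ) :
    fderiv ℝ (fderiv ℝ (highTest K ε q)) w a a =
      (K * (2 * a.re ^ 2) - (2 * a.re ^ 2 + 2 * a.im ^ 2)) *
          (w.re ^ 2 + w.im ^ 2 + ε) ^ (q - 1) +
        2 * ((K * (2 * w.re * a.re) - (2 * w.re * a.re + 2 * w.im * a.im)) *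
          ((2 * w.re * a.re + 2 * w.im * a.im) * (q - 1) *
            (w.re ^ 2 + w.im ^ 2 + ε) ^ (q - 2))) +
        (K * w.re ^ 2 - (w.re ^ 2 + w.im ^ 2 + ε)) *
          ((q - 1) * (2 * a.re ^ 2 + 2 * a.im ^ 2) * (w.re ^ 2 + w.im ^ 2 + ε) ^ (q - 2) +
            (q - 1) * (q - 2) * (2 * w.re * a.re + 2 * w.im * a.im) ^ 2 *
              (w.re ^ 2 + w.im ^ 2 + ε) ^ (q - 3)) := by
  obtain ⟨h3, h4⟩ := hasDerivAt_rpow_of_pos (fun t => by positivity)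
    (hasDerivAt_normSq_line w a ε).1 (hasDerivAt_normSq_line w a ε).2 (q - 1)
  obtain ⟨h5, h6⟩ := hasDerivAt_normSq_line w a ε
  obtain ⟨h7, h8⟩ := hasDerivAt_re_sq_line w a 0
  simp only [add_zero] at h7
  have h9 := fun t => ((h7 t).const_mul K).sub (h5 t)
  have h10 := (h8.const_mul K).sub h6
  refine fderiv_fderiv_apply_eq (contDiff_highTest K hε)
    (fun t => (h9 t).mul (h3 t)) ?_
  refine ((h10.mul (h3 0)).add ((h9 0).mul h4)).congr_deriv ?_
  simp only [Pi.sub_apply, ofReal_zero, zero_mul, add_zero, show q - 1 - 1 = q - 2 by ring,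
    show q - 1 - 2 = q - 3 by ring]
  ring

theorem subharmonic_lowTest {C : ℝ} (hε : 0 < ε) (hq : 1 / 2 < q) (hq1 : q ≤ 1)
    (hC : 2 ≤ C * (2 * q - 1)) (w a : ℂ) :
    0 ≤ fderiv ℝ (fderiv ℝ (lowTest C ε q)) w a a +
      fderiv ℝ (fderiv ℝ (lowTest C ε q)) w (a * I) (a * I) := by
  rw [fderiv_fderiv_lowTest C hε, fderiv_fderiv_lowTest C hε]
  simp only [mul_I_re, mul_I_im]
  have hs0 : 0 < w.re ^ 2 + ε := by positivity
  have hW0 : 0 < w.re ^ 2 + w.im ^ 2 + ε := by positivity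
  have hle : (w.re ^ 2 + w.im ^ 2 + ε) ^ (q - 1) ≤ (w.re ^ 2 + ε) ^ (q - 1) :=
    rpow_le_rpow_of_nonpos hs0 (by nlinarith [sq_nonneg w.im]) (by linarith)
  have es : (w.re ^ 2 + ε) ^ (q - 1) = (w.re ^ 2 + ε) ^ (q - 2) * (w.re ^ 2 + ε) := by
    rw [← rpow_add_one hs0.ne']; ring_nf
  have eW : (w.re ^ 2 + w.im ^ 2 + ε) ^ (q - 1) =
      (w.re ^ 2 + w.im ^ 2 + ε) ^ (q - 2) * (w.re ^ 2 + w.im ^ 2 + ε) := by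
    rw [← rpow_add_one hW0.ne']; ring_nf
  have hS : 0 < (w.re ^ 2 + ε) ^ (q - 2) := rpow_pos_of_pos hs0 _
  have hW : 0 < (w.re ^ 2 + w.im ^ 2 + ε) ^ (q - 2) := rpow_pos_of_pos hW0 _
  set S := (w.re ^ 2 + ε) ^ (q - 2)
  set T := (w.re ^ 2 + w.im ^ 2 + ε) ^ (q - 2)
  set S₁ := (w.re ^ 2 + ε) ^ (q - 1)
  set T₁ := (w.re ^ 2 + w.im ^ 2 + ε) ^ (q - 1)
  have hC0 : 0 ≤ C := by nlinarith
  have hT₁ : 0 ≤ T₁ := by rw [eW]; positivity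
  have h1 : (2 * q - 1) * S₁ ≤ S₁ - 2 * (1 - q) * w.re ^ 2 * S := by
    rw [es]; nlinarith [mul_nonneg (mul_nonneg (sub_nonneg.2 hq1) hε.le) hS.le]
  have h2 : 0 ≤ (1 - q) * (w.re ^ 2 + w.im ^ 2) * T :=
    mul_nonneg (mul_nonneg (by linarith) (by positivity)) hW.le
  have h3 : 2 * T₁ ≤ C * (S₁ - 2 * (1 - q) * w.re ^ 2 * S) :=
    calc 2 * T₁ ≤ C * (2 * q - 1) * S₁ := mul_le_mul hC hle hT₁ (by nlinarith)
      _ = C * ((2 * q - 1) * S₁) := by ring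
      _ ≤ _ := mul_le_mul_of_nonneg_left h1 hC0
  have key : 0 ≤ 2 * q * (a.re ^ 2 + a.im ^ 2) *
      (C * (S₁ - 2 * (1 - q) * w.re ^ 2 * S) - 2 * T₁ +
        2 * ((1 - q) * (w.re ^ 2 + w.im ^ 2) * T)) := by
    apply mul_nonneg
    · positivity
    · linarith
  refine key.trans_eq ?_
  ring

theorem subharmonic_highTest {K : ℝ} (hε : 0 < ε) (hq : 1 ≤ q)
    (hK : 2 * q ^ 2 ≤ K) (w a : ℂ) :
    0 ≤ fderiv ℝ (fderiv ℝ (highTest K ε q)) w a a +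
      fderiv ℝ (fderiv ℝ (highTest K ε q)) w (a * I) (a * I) := by
  rw [fderiv_fderiv_highTest K hε, fderiv_fderiv_highTest K hε]
  simp only [mul_I_re, mul_I_im]
  have hW0 : 0 < w.re ^ 2 + w.im ^ 2 + ε := by positivity
  have e1 : (w.re ^ 2 + w.im ^ 2 + ε) ^ (q - 1) =
      (w.re ^ 2 + w.im ^ 2 + ε) ^ (q - 3) * (w.re ^ 2 + w.im ^ 2 + ε) ^ 2 := by
    rw [← rpow_add_natCast hW0.ne']; congr 1; push_cast; ring
  have e2 : (w.re ^ 2 + w.im ^ 2 + ε) ^ (q - 2) =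
      (w.re ^ 2 + w.im ^ 2 + ε) ^ (q - 3) * (w.re ^ 2 + w.im ^ 2 + ε) := by
    rw [← rpow_add_one hW0.ne']; congr 1; ring
  have hT : 0 < (w.re ^ 2 + w.im ^ 2 + ε) ^ (q - 3) := rpow_pos_of_pos hW0 _
  rw [e1, e2]
  set T := (w.re ^ 2 + w.im ^ 2 + ε) ^ (q - 3)
  set W := w.re ^ 2 + w.im ^ 2 + ε with hWdef
  obtain ⟨n, hn⟩ : ∃ n, n = w.re ^ 2 + w.im ^ 2 := ⟨_, rfl⟩
  have hn0 : 0 ≤ n := by rw [hn]; positivity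
  have hWn : W = n + ε := by rw [hWdef, hn]
  have hm : 0 ≤ q - 1 := by linarith
  have hK0 : 0 ≤ K := le_trans (by positivity) hK
  have hb : 0 ≤ (q - 1) * n + ε := by positivity
  have key : 0 ≤ 2 * (a.re ^ 2 + a.im ^ 2) * T *
      ((K - 2 * q ^ 2) * W ^ 2 + 2 * q * (q - 1) * ε * W + 4 * K * (q - 1) * w.re ^ 2 * W +
        2 * K * (q - 1) * w.re ^ 2 * ((q - 1) * n + ε)) := by
    have := sub_nonneg.2 hK
    positivity
  refine key.trans_eq ?_
  rw [hWn, hn]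
  ring

theorem sq_rpow_half (x p : ℝ) : (x ^ 2) ^ (p / 2) = |x| ^ p := by
  rw [← sq_abs, ← rpow_natCast, ← rpow_mul (abs_nonneg x)]
  congr 1
  push_cast
  ring

theorem lowTest_le {C ε p : ℝ} (hC : 0 ≤ C) (hε : 0 < ε) (hp0 : 0 < p) (hp2 : p ≤ 2) (z : ℂ) :
    lowTest C ε (p / 2) z ≤ C * |z.re| ^ p - |z.im| ^ p + C * ε ^ (p / 2) := by
  have h1 : (z.re ^ 2 + ε) ^ (p / 2) ≤ |z.re| ^ p + ε ^ (p / 2) := by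
    rw [← sq_rpow_half]
    exact Real.rpow_add_le_add_rpow (sq_nonneg _) hε.le (by positivity) (by linarith)
  have h2 : |z.im| ^ p ≤ (z.re ^ 2 + z.im ^ 2 + ε) ^ (p / 2) := by
    rw [← sq_rpow_half]
    exact rpow_le_rpow (sq_nonneg _) (by nlinarith [sq_nonneg z.re]) (by positivity)
  rw [lowTest]
  nlinarith [mul_le_mul_of_nonneg_left h1 hC]

theorem highTest_le {K ε p : ℝ} (hK : 0 ≤ K) (hε : 0 < ε) (hp2 : 2 ≤ p) (z : ℂ) :
    highTest K ε (p / 2) z ≤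
      1 / 2 * (2 * K) ^ (p / 2) * |z.re| ^ p - 1 / 2 * |z.im| ^ p := by
  have hW0 : 0 < z.re ^ 2 + z.im ^ 2 + ε := by positivity
  have h2 : |z.im| ^ p ≤ (z.re ^ 2 + z.im ^ 2 + ε) ^ (p / 2) := by
    rw [← sq_rpow_half]
    exact rpow_le_rpow (sq_nonneg _) (by nlinarith [sq_nonneg z.re]) (by positivity)
  have h3 : (z.re ^ 2 + z.im ^ 2 + ε) ^ (p / 2) =
      (z.re ^ 2 + z.im ^ 2 + ε) ^ (p / 2 - 1) * (z.re ^ 2 + z.im ^ 2 + ε) := by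
    rw [← rpow_add_one hW0.ne']; congr 1; ring
  rw [highTest, mul_assoc, ← sq_rpow_half z.re, ← mul_rpow (by positivity) (sq_nonneg _)]
  set W := z.re ^ 2 + z.im ^ 2 + ε
  have hT : 0 < W ^ (p / 2 - 1) := rpow_pos_of_pos hW0 _
  have hX0 : 0 ≤ (2 * K * z.re ^ 2) ^ (p / 2) := by positivity
  rcases le_total (2 * K * z.re ^ 2) W with h | h
  · nlinarith
  · have hX : 0 < 2 * K * z.re ^ 2 := hW0.trans_le h
    have h4 : (2 * K * z.re ^ 2) ^ (p / 2) =
        (2 * K * z.re ^ 2) ^ (p / 2 - 1) * (2 * K * z.re ^ 2) := by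
      rw [← rpow_add_one hX.ne']; congr 1; ring
    have h5 : W ^ (p / 2 - 1) ≤ (2 * K * z.re ^ 2) ^ (p / 2 - 1) :=
      rpow_le_rpow hW0.le h (by linarith)
    nlinarith [mul_le_mul_of_nonneg_right h5 hX.le]

open Filter Topology in
/-- For each `p > 1` there are `C²` subharmonic functions, bounded above by
`C |Re z| ^ p - c |Im z| ^ p` and below on the real axis by zero, up to arbitrarily small errors. -/
theorem exists_subharmonic_test {p : ℝ} (hp : 1 < p) :
    ∃ C c : ℝ, 0 ≤ C ∧ 0 < c ∧ ∀ x δ : ℝ, 0 < δ → ∃ Φ : ℂ → ℝ, ContDiff ℝ 2 Φ ∧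
      (∀ w a : ℂ, 0 ≤ fderiv ℝ (fderiv ℝ Φ) w a a + fderiv ℝ (fderiv ℝ Φ) w (a * I) (a * I)) ∧
      -δ ≤ Φ x ∧ ∀ z : ℂ, Φ z ≤ C * |z.re| ^ p - c * |z.im| ^ p + δ := by
  rcases le_total p 2 with hp2 | hp2
  · have hC : 2 ≤ 2 / (p - 1) := by rw [le_div_iff₀ (by linarith)]; linarith
    refine ⟨2 / (p - 1), 1, by linarith, one_pos, fun x δ hδ => ?_⟩
    have hlim : Tendsto (fun ε : ℝ => 2 / (p - 1) * ε ^ (p / 2)) (𝓝[>] 0) (𝓝 0) := by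
      have : ContinuousAt (fun ε : ℝ => 2 / (p - 1) * ε ^ (p / 2)) 0 :=
        continuousAt_const.mul (continuousAt_id.rpow_const (Or.inr (by linarith)))
      have h := this.tendsto.mono_left (nhdsWithin_le_nhds (s := Ioi 0))
      rwa [zero_rpow (by linarith), mul_zero] at h
    obtain ⟨ε, hεδ, hε : 0 < ε⟩ :=
      ((hlim.eventually (gt_mem_nhds hδ)).and self_mem_nhdsWithin).exists
    refine ⟨lowTest (2 / (p - 1)) ε (p / 2), contDiff_lowTest _ hε,
      subharmonic_lowTest hε (by linarith) (by linarith) ?_, ?_, fun z => ?_⟩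
    · rw [show 2 * (p / 2) - 1 = p - 1 by ring, div_mul_cancel₀ _ (by linarith)]
    · have : 0 ≤ (x ^ 2 + ε) ^ (p / 2) := by positivity
      simp only [lowTest, ofReal_re, ofReal_im, ne_eq, OfNat.ofNat_ne_zero, not_false_eq_true,
        zero_pow, add_zero]
      nlinarith
    · have := lowTest_le (by linarith : (0 : ℝ) ≤ 2 / (p - 1)) hε (by linarith) hp2 z
      linarith
  · refine ⟨1 / 2 * (2 * (2 * (p / 2) ^ 2)) ^ (p / 2), 1 / 2, by positivity, by norm_num,
      fun x δ hδ => ?_⟩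
    have hlim : Tendsto (fun ε : ℝ => ε * (x ^ 2 + ε) ^ (p / 2 - 1)) (𝓝[>] 0) (𝓝 0) := by
      have : ContinuousAt (fun ε : ℝ => ε * (x ^ 2 + ε) ^ (p / 2 - 1)) 0 :=
        continuousAt_id.mul
          ((continuousAt_const.add continuousAt_id).rpow_const (Or.inr (by linarith)))
      have h := this.tendsto.mono_left (nhdsWithin_le_nhds (s := Ioi 0))
      rwa [zero_mul] at h
    obtain ⟨ε, hεδ, hε : 0 < ε⟩ :=
      ((hlim.eventually (gt_mem_nhds hδ)).and self_mem_nhdsWithin).exists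
    refine ⟨highTest (2 * (p / 2) ^ 2) ε (p / 2), contDiff_highTest _ hε,
      subharmonic_highTest hε (by linarith) le_rfl, ?_, fun z => ?_⟩
    · have h1 : 0 ≤ (x ^ 2 + ε) ^ (p / 2 - 1) := by positivity
      have h2 : 0 ≤ (2 * (p / 2) ^ 2 - 1) * x ^ 2 * (x ^ 2 + ε) ^ (p / 2 - 1) :=
        mul_nonneg (mul_nonneg (by nlinarith) (sq_nonneg x)) h1
      simp only [highTest, ofReal_re, ofReal_im, ne_eq, OfNat.ofNat_ne_zero, not_false_eq_true,
        zero_pow, add_zero]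
      linarith
    · have := highTest_le (by positivity : (0 : ℝ) ≤ 2 * (p / 2) ^ 2) hε hp2 z
      linarith

end TestFunctions

/-- Riesz's inequality for the real and imaginary parts of a holomorphic function. -/
theorem exists_integral_abs_im_rpow_le {p : ℝ} (hp : 1 < p) :
    ∃ B : ℝ, 0 ≤ B ∧ ∀ F : ℂ → ℂ, DifferentiableOn ℂ F (Metric.ball 0 1) → (F 0).im = 0 →
      ∀ r : ℝ, 0 < r → r < 1 →
        ∫ θ in (0 : ℝ)..(2 * π), |(F (r * exp (θ * I))).im| ^ p ≤
          B * ∫ θ in (0 : ℝ)..(2 * π), |(F (r * exp (θ * I))).re| ^ p := by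
  obtain ⟨C, c, hC, hc, htest⟩ := exists_subharmonic_test hp
  refine ⟨C / c, by positivity, fun F hF hF0 r hr0 hr1 => ?_⟩
  have hcont : Continuous fun θ : ℝ => F (r * exp (θ * I)) :=
    hF.continuousOn.comp_continuous (by fun_prop) fun θ => by
      simpa [Complex.norm_exp_ofReal_mul_I, abs_of_pos hr0] using hr1
  have hu : Continuous fun θ : ℝ => |(F (r * exp (θ * I))).re| ^ p :=
    (continuous_re.comp hcont).abs.rpow_const fun _ => Or.inr (by linarith)
  have hv : Continuous fun θ : ℝ => |(F (r * exp (θ * I))).im| ^ p :=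
    (continuous_im.comp hcont).abs.rpow_const fun _ => Or.inr (by linarith)
  rw [div_mul_eq_mul_div, le_div_iff₀' hc]
  refine le_of_forall_pos_le_add fun η hη => ?_
  obtain ⟨Φ, hΦ, hsub, hΦ0, hle⟩ := htest (F 0).re (η / (4 * π)) (by positivity)
  have hreal : ((F 0).re : ℂ) = F 0 := Complex.ext (by simp) (by simp [hF0])
  rw [hreal] at hΦ0
  have h1 := le_integral_comp_of_subharmonic hΦ hsub hF hr0 hr1
  have hdiff : Continuous fun θ : ℝ => C * |(F (r * exp (θ * I))).re| ^ p -
      c * |(F (r * exp (θ * I))).im| ^ p := (hu.const_mul C).sub (hv.const_mul c)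
  have h2 : ∫ θ in (0 : ℝ)..(2 * π), Φ (F (r * exp (θ * I))) ≤
      ∫ θ in (0 : ℝ)..(2 * π), (C * |(F (r * exp (θ * I))).re| ^ p -
        c * |(F (r * exp (θ * I))).im| ^ p + η / (4 * π)) :=
    intervalIntegral.integral_mono_on (by positivity)
      ((hΦ.continuous.comp hcont).intervalIntegrable _ _)
      ((hdiff.add continuous_const).intervalIntegrable _ _)
      fun θ _ => hle _
  rw [intervalIntegral.integral_add (hdiff.intervalIntegrable _ _)
      intervalIntegrable_const,
    intervalIntegral.integral_sub ((hu.const_mul C).intervalIntegrable _ _)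
      ((hv.const_mul c).intervalIntegrable _ _),
    intervalIntegral.integral_const_mul, intervalIntegral.integral_const_mul,
    intervalIntegral.integral_const, smul_eq_mul, sub_zero] at h2
  have h3 : 2 * π * (η / (4 * π)) = η / 2 := by field_simp; norm_num
  have h4 := mul_le_mul_of_nonneg_left hΦ0 (by positivity : (0 : ℝ) ≤ 2 * π)
  linarith

theorem circleMeanR_congr {p r : ℝ} {u u' : ℂ → ℝ} (h : ∀ z ∈ unitDisk, u' z = u z)
    (hr0 : 0 < r) (hr1 : r < 1) : circleMeanR p u r = circleMeanR p u' r := by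
  have hz : ∀ θ : ℝ, (r * exp (θ * I) : ℂ) ∈ unitDisk := fun θ => by
    simpa [unitDisk, Complex.norm_exp_ofReal_mul_I, abs_of_pos hr0] using hr1
  simp only [circleMeanR, h _ (hz _)]

/-- M. Riesz's theorem: for `1 < p < ∞`, the harmonic conjugate of an `h^p` function is
in `h^p`, with a uniform constant `A_p`. -/
theorem riesz_conjugate (p : ℝ) (hp1 : 1 < p) :
    ∃ A : ℝ, ∀ (u v : ℂ → ℝ) (F : ℂ → ℂ),
      DifferentiableOn ℂ F unitDisk →
      (∀ z ∈ unitDisk, (F z).re = u z) →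
      (∀ z ∈ unitDisk, (F z).im = v z) →
      v 0 = 0 →
      InHardyR p u →
      InHardyR p v ∧ ∀ r : ℝ, 0 < r → r < 1 → circleMeanR p v r ≤ A * circleMeanR p u r := by
  obtain ⟨B, hB, hriesz⟩ := exists_integral_abs_im_rpow_le hp1
  refine ⟨B ^ (1 / p), fun u v F hF hu hv hv0 ⟨M, hM⟩ => ?_⟩
  have hF0 : (F 0).im = 0 := (hv 0 (by simp [unitDisk])).trans hv0
  have hmean : ∀ r : ℝ, 0 < r → r < 1 →
      circleMeanR p v r ≤ B ^ (1 / p) * circleMeanR p u r := by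
    intro r hr0 hr1
    have nonneg : ∀ g : ℝ → ℝ, 0 ≤ ∫ θ in (0 : ℝ)..(2 * π), |g θ| ^ p := fun g =>
      intervalIntegral.integral_nonneg (by positivity) fun θ _ => by positivity
    rw [circleMeanR_congr hv hr0 hr1, circleMeanR_congr hu hr0 hr1, circleMeanR, circleMeanR,
      ← mul_rpow hB (mul_nonneg (by positivity) (nonneg _)), mul_left_comm]
    exact rpow_le_rpow (mul_nonneg (by positivity) (nonneg _))
      (mul_le_mul_of_nonneg_left (hriesz F hF hF0 r hr0 hr1) (by positivity)) (by positivity)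
  refine ⟨⟨B ^ (1 / p) * M, fun r hr0 hr1 => (hmean r hr0 hr1).trans ?_⟩, hmean⟩
  exact mul_le_mul_of_nonneg_left (hM r hr0 hr1) (by positivity)
end
end

section
/- (Zygmund) Let u be a real-valued harmonic function in the unit disk 𝔻 belonging to the class h·log⁺h, and let v be its harmonic conjugate normalized by v(0) = 0. Then v ∈ h¹, and for every 0 < r < 1, M₁(r,v) ≤ (1/2π)∫₀^{2π} |u(re^{iθ})| log⁺|u(re^{iθ})| dθ + 3e. -/
open Complex Real Set

noncomputable section

/-- `log⁺ x = max (log x) 0`. -/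
def logPlus (x : ℝ) : ℝ := max (Real.log x) 0

/-- The integral `∫₀^{2π} |u(re^{iθ})| log⁺|u(re^{iθ})| dθ`. -/
def zygmundIntegral (u : ℂ → ℝ) (r : ℝ) : ℝ :=
  ∫ θ in (0:ℝ)..(2 * π),
    |u (r * Complex.exp (θ * Complex.I))| * logPlus |u (r * Complex.exp (θ * Complex.I))|

/-- The class `h·log⁺h`: real-valued harmonic functions with uniformly bounded
`∫ |u| log⁺|u|` integrals. -/
def InZygmundClass (u : ℂ → ℝ) : Prop :=
  ∃ C : ℝ, ∀ r : ℝ, 0 < r → r < 1 → zygmundIntegral u r ≤ C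

/-- Differentiation under the integral sign for a jointly continuous family. -/
theorem hasDerivAt_intervalIntegral_of_continuousOn {f f' : ℝ → ℝ → ℝ} {R : ℝ} (a b : ℝ)
    (hf : ContinuousOn (fun p : ℝ × ℝ => f p.1 p.2) (Ioo (-R) R ×ˢ univ))
    (hf' : ContinuousOn (fun p : ℝ × ℝ => f' p.1 p.2) (Ioo (-R) R ×ˢ univ))
    (hd : ∀ r ∈ Ioo (-R) R, ∀ θ, HasDerivAt (fun s => f s θ) (f' r θ) r)
    {r : ℝ} (hr : r ∈ Ioo (-R) R) :
    HasDerivAt (fun s => ∫ θ in a..b, f s θ) (∫ θ in a..b, f' r θ) r := by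
  have slice : ∀ {g : ℝ → ℝ → ℝ},
      ContinuousOn (fun p : ℝ × ℝ => g p.1 p.2) (Ioo (-R) R ×ˢ univ) →
      ∀ s ∈ Ioo (-R) R, Continuous (g s) := by
    intro g hg s hs
    exact hg.comp_continuous (f := fun θ => (s, θ)) (by fun_prop) (fun θ => ⟨hs, mem_univ _⟩)
  obtain ⟨δ, hδ, hball⟩ := Metric.nhds_basis_closedBall.mem_iff.1 (Ioo_mem_nhds hr.1 hr.2)
  obtain ⟨C, hC⟩ := ((isCompact_closedBall r δ).prod (isCompact_uIcc (a := a) (b := b)))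
    |>.exists_bound_of_continuousOn (hf'.mono (prod_mono hball (subset_univ _)))
  refine (intervalIntegral.hasDerivAt_integral_of_dominated_loc_of_deriv_le
    (s := Metric.closedBall r δ) (bound := fun _ => C) (F := f) (F' := f')
    (Metric.closedBall_mem_nhds r hδ) ?_ ?_ ?_ ?_ ?_ ?_).2
  · filter_upwards [Ioo_mem_nhds hr.1 hr.2] with s hs
    exact (slice hf s hs).aestronglyMeasurable
  · exact (slice hf r hr).intervalIntegrable _ _
  · exact (slice hf' r hr).aestronglyMeasurable
  · exact .of_forall fun θ hθ s hs => hC (s, θ) ⟨hs, uIoc_subset_uIcc hθ⟩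
  · exact intervalIntegrable_const
  · exact .of_forall fun θ _ s hs => hd s (hball hs) θ

/-- The super-mean-value property of a `C²` function whose Laplacian, computed in every rotated
orthonormal frame, is nonpositive. -/
theorem integral_circleMap_le_of_fderiv_fderiv_nonpos {ψ : ℂ → ℝ} {R : ℝ}
    (hψ : ContDiffOn ℝ 2 ψ (Metric.ball 0 R))
    (hΔ : ∀ z ∈ Metric.ball (0 : ℂ) R, ∀ e : ℂ,
      fderiv ℝ (fderiv ℝ ψ) z e e + fderiv ℝ (fderiv ℝ ψ) z (e * I) (e * I) ≤ 0)
    {r : ℝ} (hr0 : 0 < r) (hr : r < R) :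
    ∫ θ in (0 : ℝ)..2 * π, ψ (circleMap 0 r θ) ≤ 2 * π * ψ 0 := by
  set B := Metric.ball (0 : ℂ) R
  have hB : IsOpen B := Metric.isOpen_ball
  set D := fderiv ℝ ψ
  set E := fderiv ℝ D
  have hD1 : ContDiffOn ℝ 1 D B := hψ.fderiv_of_isOpen hB (by norm_num)
  have hE0 : ContDiffOn ℝ 0 E B := hD1.fderiv_of_isOpen hB (by norm_num)
  have hDψ : ∀ z ∈ B, HasFDerivAt ψ (D z) z := fun z hz =>
    ((hψ.differentiableOn (by norm_num)).differentiableAt (hB.mem_nhds hz)).hasFDerivAt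
  have hED : ∀ z ∈ B, HasFDerivAt D (E z) z := fun z hz =>
    ((hD1.differentiableOn (by norm_num)).differentiableAt (hB.mem_nhds hz)).hasFDerivAt
  set e : ℝ → ℂ := circleMap 0 1
  have hec : Continuous e := by fun_prop
  have hmem : ∀ s ∈ Ioo (-R) R, ∀ θ, (s : ℂ) * e θ ∈ B := by
    intro s hs θ
    simp [B, e, circleMap, abs_lt, hs.1, hs.2]
  have hpt : MapsTo (fun p : ℝ × ℝ => (p.1 : ℂ) * e p.2) (Ioo (-R) R ×ˢ univ) B :=
    fun p hp => hmem p.1 hp.1 p.2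
  have hptc : ContinuousOn (fun p : ℝ × ℝ => (p.1 : ℂ) * e p.2) (Ioo (-R) R ×ˢ univ) := by
    fun_prop
  have hψc := hψ.continuousOn.comp hptc hpt
  have hDc := hD1.continuousOn.comp hptc hpt
  have hEc := hE0.continuousOn.comp hptc hpt
  have heI : ∀ θ, HasDerivAt e (e θ * I) θ := fun θ => hasDerivAt_circleMap 0 1 θ
  have hrad : ∀ s θ, HasDerivAt (fun s : ℝ => (s : ℂ) * e θ) (e θ) s := by
    intro s θ
    simpa using (ofRealCLM.hasDerivAt (x := s)).mul_const (e θ)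
  have hper : e (2 * π) = e 0 := by simp [e, circleMap]
  have hcm : ∀ θ, circleMap 0 r θ = r * e θ := fun θ => by simp [e, circleMap]
  clear_value D E e
  set k : ℝ → ℝ := fun s => ∫ θ in (0 : ℝ)..2 * π, D (s * e θ) (e θ)
  set l : ℝ → ℝ := fun s => ∫ θ in (0 : ℝ)..2 * π, (D (s * e θ) (e θ) + s * E (s * e θ) (e θ) (e θ))
  have hm : ∀ s ∈ Ioo (-R) R,
      HasDerivAt (fun s : ℝ => ∫ θ in (0 : ℝ)..2 * π, ψ (s * e θ)) (k s) s := by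
    intro s hs
    refine hasDerivAt_intervalIntegral_of_continuousOn (f := fun s θ => ψ (s * e θ))
      (f' := fun s θ => D (s * e θ) (e θ)) _ _ hψc ?_ ?_ hs
    · exact hDc.clm_apply (by fun_prop)
    · intro s hs θ
      exact (hDψ _ (hmem s hs θ)).comp_hasDerivAt s (hrad s θ)
  have hk : ∀ s ∈ Ioo (-R) R, HasDerivAt (fun s => s * k s) (l s) s := by
    intro s hs
    have := hasDerivAt_intervalIntegral_of_continuousOn (f := fun s θ => s * D (s * e θ) (e θ))
      (f' := fun s θ => D (s * e θ) (e θ) + s * E (s * e θ) (e θ) (e θ)) (R := R) 0 (2 * π)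
      ?_ ?_ ?_ hs
    · simpa [k] using this
    · exact continuousOn_fst.mul (hDc.clm_apply (by fun_prop))
    · exact (hDc.clm_apply (by fun_prop)).add (continuousOn_fst.mul
        ((hEc.clm_apply (by fun_prop)).clm_apply (by fun_prop)))
    · intro s hs θ
      have h0 : HasDerivAt (fun s : ℝ => D (s * e θ)) (E (s * e θ) (e θ)) s :=
        (hED _ (hmem s hs θ)).comp_hasDerivAt s (hrad s θ)
      have h1 := h0.clm_apply (hasDerivAt_const s (e θ))
      have h2 := (hasDerivAt_id s).mul h1
      simp only [map_zero, add_zero, one_mul, id] at h2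
      exact h2
  have hl : ∀ s ∈ Ioo 0 R, l s ≤ 0 := by
    intro s hs
    have hs' : s ∈ Ioo (-R) R := ⟨by linarith [hs.1, hs.2], hs.2⟩
    have hcirc : ∀ θ, HasDerivAt (fun θ : ℝ => (s : ℂ) * e θ) (s * (e θ * I)) θ :=
      fun θ => (heI θ).const_mul _
    have hEs : Continuous fun θ => E (s * e θ) :=
      hE0.continuousOn.comp_continuous (by fun_prop) (hmem s hs')
    have hDs : Continuous fun θ => D (s * e θ) :=
      hD1.continuousOn.comp_continuous (by fun_prop) (hmem s hs')
    have heIc : Continuous fun θ => e θ * I := hec.mul continuous_const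
    have hc1 : Continuous fun θ => D (s * e θ) (e θ) := hDs.clm_apply hec
    have hc2 : Continuous fun θ => s * E (s * e θ) (e θ) (e θ) :=
      continuous_const.mul ((hEs.clm_apply hec).clm_apply hec)
    have hc3 : Continuous fun θ => s * E (s * e θ) (e θ * I) (e θ * I) :=
      continuous_const.mul ((hEs.clm_apply heIc).clm_apply heIc)
    have htan : ∀ θ, HasDerivAt (fun θ => D (s * e θ) (e θ * I))
        (s * E (s * e θ) (e θ * I) (e θ * I) - D (s * e θ) (e θ)) θ := by
      intro θ
      have h0 : HasDerivAt (fun θ => D (s * e θ)) (E (s * e θ) (s * (e θ * I))) θ :=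
        (hED _ (hmem s hs' θ)).comp_hasDerivAt θ (hcirc θ)
      have h1 := h0.clm_apply ((heI θ).mul_const I)
      have h2 : E (s * e θ) (s * (e θ * I)) = s • E (s * e θ) (e θ * I) := by
        have h := (E (s * e θ)).map_smul s (e θ * I)
        rwa [Complex.real_smul] at h
      have h3 : e θ * I * I = - e θ := by rw [mul_assoc, I_mul_I]; ring
      rw [h2, h3] at h1
      simpa [sub_eq_add_neg] using h1
    have hint := intervalIntegral.integral_eq_sub_of_hasDerivAt (a := 0) (b := 2 * π)
      (fun θ _ => htan θ) ((hc3.sub hc1).intervalIntegrable _ _)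
    rw [hper, sub_self] at hint
    have hsum : l s = ∫ θ in (0 : ℝ)..2 * π,
        s * (E (s * e θ) (e θ) (e θ) + E (s * e θ) (e θ * I) (e θ * I)) := by
      conv_lhs => rw [← add_zero (l s), ← hint]
      rw [ ← intervalIntegral.integral_add]
      · congr 1
        ext θ
        ring
      · exact (hc1.add hc2).intervalIntegrable _ _
      · exact (hc3.sub hc1).intervalIntegrable _ _
    rw [hsum]
    rw [← neg_nonneg, ← intervalIntegral.integral_neg]
    refine intervalIntegral.integral_nonneg (by positivity) fun θ _ => ?_
    rw [neg_nonneg]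
    exact mul_nonpos_of_nonneg_of_nonpos hs.1.le (hΔ _ (hmem s hs' θ) _)
  have hIcc : ∀ s ∈ Icc 0 r, s ∈ Ioo (-R) R := fun s hs =>
    ⟨by linarith [hs.1, hs.2], by linarith [hs.2]⟩
  have hkneg : ∀ s ∈ Ioo 0 r, k s ≤ 0 := by
    have hanti : AntitoneOn (fun s => s * k s) (Icc 0 r) := by
      refine antitoneOn_of_hasDerivWithinAt_nonpos (f' := l) (convex_Icc 0 r)
        (fun s hs => (hk s (hIcc s hs)).continuousAt.continuousWithinAt)
        (fun s hs => (hk s (hIcc s (interior_subset hs))).hasDerivWithinAt) ?_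
      intro s hs
      rw [interior_Icc] at hs
      exact hl s ⟨hs.1, hs.2.trans hr⟩
    intro s hs
    have := hanti (left_mem_Icc.2 hr0.le) (Ioo_subset_Icc_self hs) hs.1.le
    simp only [zero_mul] at this
    exact nonpos_of_mul_nonpos_right this hs.1
  have hanti : AntitoneOn (fun s : ℝ => ∫ θ in (0 : ℝ)..2 * π, ψ (s * e θ)) (Icc 0 r) := by
    refine antitoneOn_of_hasDerivWithinAt_nonpos (f' := k) (convex_Icc 0 r)
      (fun s hs => (hm s (hIcc s hs)).continuousAt.continuousWithinAt)
      (fun s hs => (hm s (hIcc s (interior_subset hs))).hasDerivWithinAt) ?_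
    intro s hs
    rw [interior_Icc] at hs
    exact hkneg s hs
  have := hanti (left_mem_Icc.2 hr0.le) (right_mem_Icc.2 hr0.le) hr0.le
  simpa [hcm] using this

/-- The function `√(1 + x² + y²) - x arsinh x`, whose composition with any analytic function
`x + iy` is superharmonic. -/
def zygmundMajorant (x y : ℝ) : ℝ := √(1 + x ^ 2 + y ^ 2) - x * arsinh x

/-- The partial derivative of `zygmundMajorant` in the first variable. -/
def zygmundMajorantFst (x y : ℝ) : ℝ :=
  x / √(1 + x ^ 2 + y ^ 2) - arsinh x - x / √(1 + x ^ 2)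

/-- The partial derivative of `zygmundMajorant` in the second variable. -/
def zygmundMajorantSnd (x y : ℝ) : ℝ := y / √(1 + x ^ 2 + y ^ 2)

section ChainRule

variable {X Y : ℝ → ℝ} {X' Y' t : ℝ}

theorem hasDerivAt_sqrt_one_add_sq_add_sq (hX : HasDerivAt X X' t) (hY : HasDerivAt Y Y' t) :
    HasDerivAt (fun s => √(1 + X s ^ 2 + Y s ^ 2))
      ((X t * X' + Y t * Y') / √(1 + X t ^ 2 + Y t ^ 2)) t := by
  have h := (((hX.pow 2).const_add 1).add (hY.pow 2)).sqrt
    (by simp only [Pi.add_apply, Pi.pow_apply]; positivity)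
  refine h.congr_deriv ?_
  simp only [Pi.add_apply, Pi.pow_apply]
  field_simp
  ring

theorem hasDerivAt_sqrt_one_add_sq (hX : HasDerivAt X X' t) :
    HasDerivAt (fun s => √(1 + X s ^ 2)) (X t * X' / √(1 + X t ^ 2)) t := by
  simpa using hasDerivAt_sqrt_one_add_sq_add_sq hX (hasDerivAt_const t (0 : ℝ))

theorem hasDerivAt_zygmundMajorant (hX : HasDerivAt X X' t) (hY : HasDerivAt Y Y' t) :
    HasDerivAt (fun s => zygmundMajorant (X s) (Y s))
      (zygmundMajorantFst (X t) (Y t) * X' + zygmundMajorantSnd (X t) (Y t) * Y') t := by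
  refine ((hasDerivAt_sqrt_one_add_sq_add_sq hX hY).sub (hX.mul hX.arsinh)).congr_deriv ?_
  simp only [zygmundMajorantFst, zygmundMajorantSnd, smul_eq_mul]
  ring

theorem hasDerivAt_zygmundMajorantFst (hX : HasDerivAt X X' t) (hY : HasDerivAt Y Y' t) :
    HasDerivAt (fun s => zygmundMajorantFst (X s) (Y s))
      ((1 / √(1 + X t ^ 2 + Y t ^ 2) - X t ^ 2 / √(1 + X t ^ 2 + Y t ^ 2) ^ 3
          - 1 / √(1 + X t ^ 2) - 1 / √(1 + X t ^ 2) ^ 3) * X'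
        - X t * Y t / √(1 + X t ^ 2 + Y t ^ 2) ^ 3 * Y') t := by
  have hG : √(1 + X t ^ 2 + Y t ^ 2) ≠ 0 := by positivity
  have hS : √(1 + X t ^ 2) ≠ 0 := by positivity
  have hS2 : √(1 + X t ^ 2) ^ 2 = 1 + X t ^ 2 := Real.sq_sqrt (by positivity)
  refine (((hX.div (hasDerivAt_sqrt_one_add_sq_add_sq hX hY) hG).sub hX.arsinh).sub
    (hX.div (hasDerivAt_sqrt_one_add_sq hX) hS)).congr_deriv ?_
  simp only [smul_eq_mul]
  set G := √(1 + X t ^ 2 + Y t ^ 2)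
  set S := √(1 + X t ^ 2)
  have hX2 : X t ^ 2 = S ^ 2 - 1 := by rw [hS2]; ring
  have h1 : (X' * S - X t * (X t * X' / S)) / S ^ 2 = X' / S ^ 3 := by
    field_simp
    rw [hX2]
    ring
  rw [h1]
  field_simp
  ring

theorem hasDerivAt_zygmundMajorantSnd (hX : HasDerivAt X X' t) (hY : HasDerivAt Y Y' t) :
    HasDerivAt (fun s => zygmundMajorantSnd (X s) (Y s))
      ((1 / √(1 + X t ^ 2 + Y t ^ 2) - Y t ^ 2 / √(1 + X t ^ 2 + Y t ^ 2) ^ 3) * Y'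
        - X t * Y t / √(1 + X t ^ 2 + Y t ^ 2) ^ 3 * X') t := by
  have hG : √(1 + X t ^ 2 + Y t ^ 2) ≠ 0 := by positivity
  refine (hY.div (hasDerivAt_sqrt_one_add_sq_add_sq hX hY) hG).congr_deriv ?_
  field_simp
  ring

end ChainRule

theorem contDiffOn_zygmundMajorant_comp {F : ℂ → ℂ} {U : Set ℂ} (hU : IsOpen U)
    (hF : DifferentiableOn ℂ F U) :
    ContDiffOn ℝ 2 (fun z => zygmundMajorant (F z).re (F z).im) U := by
  have hF2 : ContDiffOn ℝ 2 F U := (hF.contDiffOn hU).restrict_scalars ℝ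
  have hre : ContDiffOn ℝ 2 (fun z => (F z).re) U := reCLM.contDiff.comp_contDiffOn hF2
  have him : ContDiffOn ℝ 2 (fun z => (F z).im) U := imCLM.contDiff.comp_contDiffOn hF2
  exact (((contDiffOn_const.add (hre.pow 2)).add (him.pow 2)).sqrt
    (fun z _ => by positivity)).sub (hre.mul hre.arsinh)

/-- Second directional derivatives of `zygmundMajorant ∘ F` along a direction `e` and its
rotation add up to a nonpositive number. -/
theorem fderiv_fderiv_zygmundMajorant_comp_nonpos {F : ℂ → ℂ} {U : Set ℂ} (hU : IsOpen U)
    (hF : DifferentiableOn ℂ F U) {z : ℂ} (hz : z ∈ U) (e : ℂ) :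
    fderiv ℝ (fderiv ℝ fun z => zygmundMajorant (F z).re (F z).im) z e e
      + fderiv ℝ (fderiv ℝ fun z => zygmundMajorant (F z).re (F z).im) z (e * I) (e * I) ≤ 0 := by
  set ψ : ℂ → ℝ := fun z => zygmundMajorant (F z).re (F z).im
  have hψ : ContDiffOn ℝ 2 ψ U := contDiffOn_zygmundMajorant_comp hU hF
  have hF' : DifferentiableOn ℂ (deriv F) U := hF.deriv hU
  have hline : ∀ (w e : ℂ), HasDerivAt (fun t : ℝ => w + t * e) e 0 := by
    intro w e
    simpa using ((ofRealCLM.hasDerivAt (x := 0)).mul_const e).const_add w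
  have hcomp : ∀ {g : ℂ → ℂ}, DifferentiableOn ℂ g U → ∀ w ∈ U, ∀ e : ℂ,
      HasDerivAt (fun t : ℝ => g (w + t * e)) (deriv g w * e) 0 := by
    intro g hg w hw e
    have h := (hg.differentiableAt (hU.mem_nhds hw)).hasDerivAt
    exact HasDerivAt.comp_of_eq (0 : ℝ) h (hline w e) (by simp)
  have hre : ∀ {g : ℝ → ℂ} {g' : ℂ}, HasDerivAt g g' 0 →
      HasDerivAt (fun t => (g t).re) g'.re 0 := fun h =>
    reCLM.hasFDerivAt.comp_hasDerivAt 0 h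
  have him : ∀ {g : ℝ → ℂ} {g' : ℂ}, HasDerivAt g g' 0 →
      HasDerivAt (fun t => (g t).im) g'.im 0 := fun h =>
    imCLM.hasFDerivAt.comp_hasDerivAt 0 h
  have hD : ∀ w ∈ U, ∀ e : ℂ, fderiv ℝ ψ w e =
      zygmundMajorantFst (F w).re (F w).im * (deriv F w * e).re
        + zygmundMajorantSnd (F w).re (F w).im * (deriv F w * e).im := by
    intro w hw e
    have h1 := ((hψ.differentiableOn (by norm_num)).differentiableAt
      (hU.mem_nhds hw)).hasFDerivAt
    have h2 : HasDerivAt (fun t : ℝ => ψ (w + t * e)) (fderiv ℝ ψ w e) 0 :=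
      HasFDerivAt.comp_hasDerivAt_of_eq (0 : ℝ) h1 (hline w e) (by simp)
    have h3 := hasDerivAt_zygmundMajorant (hre (hcomp hF w hw e)) (him (hcomp hF w hw e))
    simpa using h2.unique h3
  set x := (F z).re
  set y := (F z).im
  set G := √(1 + x ^ 2 + y ^ 2)
  set S := √(1 + x ^ 2)
  have hE : ∀ e : ℂ, fderiv ℝ (fderiv ℝ ψ) z e e =
      (1 / G - x ^ 2 / G ^ 3 - 1 / S - 1 / S ^ 3) * (deriv F z * e).re ^ 2
      - 2 * (x * y / G ^ 3) * (deriv F z * e).re * (deriv F z * e).im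
      + (1 / G - y ^ 2 / G ^ 3) * (deriv F z * e).im ^ 2
      + zygmundMajorantFst x y * (deriv (deriv F) z * e * e).re
      + zygmundMajorantSnd x y * (deriv (deriv F) z * e * e).im := by
    intro e
    have hD1 : ContDiffOn ℝ 1 (fderiv ℝ ψ) U := hψ.fderiv_of_isOpen hU (by norm_num)
    have h1 := ((hD1.differentiableOn (by norm_num)).differentiableAt
      (hU.mem_nhds hz)).hasFDerivAt
    have h2 : HasDerivAt (fun t : ℝ => fderiv ℝ ψ (z + t * e)) (fderiv ℝ (fderiv ℝ ψ) z e) 0 :=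
      HasFDerivAt.comp_hasDerivAt_of_eq (0 : ℝ) h1 (hline z e) (by simp)
    have h3 := h2.clm_apply (hasDerivAt_const (0 : ℝ) e)
    have hX := hre (hcomp hF z hz e)
    have hY := him (hcomp hF z hz e)
    have hF'e := (hcomp hF' z hz e).mul_const e
    have h4 := ((hasDerivAt_zygmundMajorantFst hX hY).mul (hre hF'e)).add
      ((hasDerivAt_zygmundMajorantSnd hX hY).mul (him hF'e))
    have hev : ∀ᶠ t : ℝ in nhds 0, z + t * e ∈ U :=
      (hline z e).continuousAt.eventually_mem (hU.mem_nhds (by simpa using hz))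
    have h5 := h4.congr_of_eventuallyEq (hev.mono fun t ht => hD (z + t * e) ht e)
    have h6 := h3.unique h5
    simp only [map_zero, add_zero, ofReal_zero, zero_mul] at h6
    rw [h6]
    ring
  have hre1 : (deriv F z * (e * I)).re = - (deriv F z * e).im := by simp; ring
  have him1 : (deriv F z * (e * I)).im = (deriv F z * e).re := by
    simp [sub_eq_add_neg]
  have hrot : deriv (deriv F) z * (e * I) * (e * I) = - (deriv (deriv F) z * e * e) := by
    linear_combination deriv (deriv F) z * e * e * I_mul_I
  rw [hE, hE, hre1, him1, hrot, neg_re, neg_im]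
  have hG : 0 < G := by positivity
  have hS : 0 < S := by positivity
  have hG2 : G ^ 2 = 1 + x ^ 2 + y ^ 2 := Real.sq_sqrt (by positivity)
  have hSG : S ≤ G := Real.sqrt_le_sqrt (by nlinarith [sq_nonneg y])
  have h1 : 1 / G ≤ 1 / S := by gcongr
  have h3 : 1 / G ^ 3 ≤ 1 / S ^ 3 := by gcongr
  have hxy : x ^ 2 / G ^ 3 + y ^ 2 / G ^ 3 = 1 / G - 1 / G ^ 3 := by
    have : x ^ 2 + y ^ 2 = G ^ 2 - 1 := by rw [hG2]; ring
    rw [← add_div, this]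
    field_simp
  have hsum : 2 / G - (x ^ 2 / G ^ 3 + y ^ 2 / G ^ 3) - 1 / S - 1 / S ^ 3 ≤ 0 := by
    rw [hxy, show 2 / G = 1 / G + 1 / G by ring]
    linarith
  have := mul_nonpos_of_nonneg_of_nonpos
    (add_nonneg (sq_nonneg (deriv F z * e).re) (sq_nonneg (deriv F z * e).im)) hsum
  refine le_of_eq_of_le ?_ this
  ring

theorem zygmundMajorant_zero_le_one (x : ℝ) : zygmundMajorant x 0 ≤ 1 := by
  wlog hx : 0 ≤ x generalizing x
  · simpa [zygmundMajorant] using this (-x) (by linarith)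
  have hS2 : √(1 + x ^ 2) ^ 2 = 1 + x ^ 2 := Real.sq_sqrt (by positivity)
  have hS : 0 < √(1 + x ^ 2) := by positivity
  have hlog : 1 + x - √(1 + x ^ 2) ≤ arsinh x := by
    have h := Real.one_sub_inv_le_log_of_pos (x := x + √(1 + x ^ 2)) (by positivity)
    have hinv : (x + √(1 + x ^ 2))⁻¹ = √(1 + x ^ 2) - x := by
      refine inv_eq_of_mul_eq_one_right ?_
      linear_combination hS2
    rw [hinv] at h
    rw [arsinh]
    linarith
  have h1 := mul_le_mul_of_nonneg_left hlog hx
  have h2 : (1 + x) * √(1 + x ^ 2) ≤ 1 + x + x ^ 2 := by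
    refine abs_le_of_sq_le_sq' ?_ (by positivity) |>.2
    rw [mul_pow, hS2]
    nlinarith [sq_nonneg x]
  simp only [zygmundMajorant, ne_eq, OfNat.ofNat_ne_zero, not_false_eq_true, zero_pow, add_zero]
  nlinarith

theorem abs_le_zygmundMajorant_add (x y : ℝ) : |y| ≤ zygmundMajorant x y + x * arsinh x := by
  rw [zygmundMajorant, sub_add_cancel]
  exact Real.abs_le_sqrt (by nlinarith [sq_nonneg x])

theorem logPlus_eq_posLog (x : ℝ) : logPlus x = Real.posLog x := by
  rw [logPlus, Real.posLog, max_comm]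

theorem mul_arsinh_div_three_le (x : ℝ) : x * arsinh (x / 3) ≤ |x| * logPlus |x| + 4 / 3 := by
  wlog hx : 0 ≤ x generalizing x
  · have := this (-x) (by linarith)
    simpa [neg_div] using this
  rw [abs_of_nonneg hx]
  have hlp : 0 ≤ logPlus x := le_max_right _ _
  have hS2 : √(1 + (x / 3) ^ 2) ^ 2 = 1 + (x / 3) ^ 2 := Real.sq_sqrt (by positivity)
  have hS : 0 < √(1 + (x / 3) ^ 2) := by positivity
  rcases le_total x 2 with h2 | h2
  · have harsinh : arsinh (x / 3) ≤ x / 3 := by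
      rw [← Real.sinh_le_sinh, Real.sinh_arsinh]
      exact Real.self_le_sinh_iff.2 (by positivity)
    have := mul_le_mul_of_nonneg_left harsinh hx
    nlinarith [mul_nonneg hx hlp]
  · have hle : arsinh (x / 3) ≤ logPlus x := by
      refine le_trans ?_ (le_max_left _ _)
      rw [arsinh]
      refine Real.log_le_log (by positivity) ?_
      have : √(1 + (x / 3) ^ 2) ≤ 2 * x / 3 := by
        rw [Real.sqrt_le_left (by positivity)]
        nlinarith
      linarith
    nlinarith [mul_le_mul_of_nonneg_left hle hx]

theorem circleMeanR_conj_le (u v : ℂ → ℝ) (F : ℂ → ℂ)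
    (hF : DifferentiableOn ℂ F unitDisk)
    (hre : ∀ z ∈ unitDisk, (F z).re = u z)
    (him : ∀ z ∈ unitDisk, (F z).im = v z)
    (hv0 : v 0 = 0) {r : ℝ} (hr0 : 0 < r) (hr : r < 1) :
    circleMeanR 1 v r ≤ (1 / (2 * π)) * zygmundIntegral u r + 3 * Real.exp 1 := by
  have hU : IsOpen unitDisk := Metric.isOpen_ball
  have hmem : ∀ θ : ℝ, (r * Complex.exp (θ * Complex.I) : ℂ) ∈ unitDisk := by
    intro θ
    simp [unitDisk, Complex.norm_exp_ofReal_mul_I, abs_of_pos hr0, hr]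
  have hFc : Continuous fun θ : ℝ => F (r * Complex.exp (θ * Complex.I)) :=
    hF.continuousOn.comp_continuous (by fun_prop) hmem
  have huc : Continuous fun θ : ℝ => u (r * Complex.exp (θ * Complex.I)) := by
    simpa only [Function.comp_def, hre _ (hmem _)] using continuous_re.comp hFc
  have hvc : Continuous fun θ : ℝ => v (r * Complex.exp (θ * Complex.I)) := by
    simpa only [Function.comp_def, him _ (hmem _)] using continuous_im.comp hFc
  set ψ : ℂ → ℝ := fun z => zygmundMajorant (F z / 3).re (F z / 3).im
  have hF3 : DifferentiableOn ℂ (fun z => F z / 3) unitDisk := hF.div_const 3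
  have hψ := contDiffOn_zygmundMajorant_comp hU hF3
  have hmean : ∫ θ in (0 : ℝ)..2 * π, ψ (r * Complex.exp (θ * Complex.I)) ≤ 2 * π * ψ 0 := by
    simpa [circleMap] using integral_circleMap_le_of_fderiv_fderiv_nonpos (ψ := ψ) hψ
      (fun z hz e => fderiv_fderiv_zygmundMajorant_comp_nonpos hU hF3 hz e) hr0 hr
  have hψ0 : ψ 0 ≤ 1 := by
    have h0 : (F 0).im = 0 := by rw [him 0 (by simp [unitDisk]), hv0]
    have : (F 0 / 3).im = 0 := by simp [h0]
    simp only [ψ, this]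
    exact zygmundMajorant_zero_le_one _
  have hψc : Continuous fun θ : ℝ => ψ (r * Complex.exp (θ * Complex.I)) :=
    hψ.continuousOn.comp_continuous (by fun_prop) hmem
  have hlogc : Continuous fun θ : ℝ => |u (r * Complex.exp (θ * Complex.I))| *
      logPlus |u (r * Complex.exp (θ * Complex.I))| := by
    simp only [logPlus_eq_posLog]
    exact huc.abs.mul (Real.continuous_posLog.comp huc.abs)
  have hpt : ∀ θ : ℝ, |v (r * Complex.exp (θ * Complex.I))| ≤
      3 * ψ (r * Complex.exp (θ * Complex.I)) + (|u (r * Complex.exp (θ * Complex.I))| *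
      logPlus |u (r * Complex.exp (θ * Complex.I))| + 4 / 3) := by
    intro θ
    set w : ℂ := r * Complex.exp (θ * Complex.I)
    have hre3 : (F w / 3).re = u w / 3 := by simp [hre w (hmem θ)]
    have him3 : (F w / 3).im = v w / 3 := by simp [him w (hmem θ)]
    have h1 := abs_le_zygmundMajorant_add (u w / 3) (v w / 3)
    have h2 := mul_arsinh_div_three_le (u w)
    rw [abs_div, abs_of_pos (by norm_num : (0 : ℝ) < 3)] at h1
    simp only [ψ, hre3, him3]
    linarith
  have hint : ∫ θ in (0 : ℝ)..2 * π, |v (r * Complex.exp (θ * Complex.I))| ≤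
      3 * (2 * π * ψ 0) + (zygmundIntegral u r + 2 * π * (4 / 3)) := by
    have hψ3 : Continuous fun θ : ℝ => 3 * ψ (r * Complex.exp (θ * Complex.I)) :=
      continuous_const.mul hψc
    have hlog43 : Continuous fun θ : ℝ => |u (r * Complex.exp (θ * Complex.I))| *
        logPlus |u (r * Complex.exp (θ * Complex.I))| + 4 / 3 := hlogc.add continuous_const
    have hsumc : Continuous fun θ : ℝ => 3 * ψ (r * Complex.exp (θ * Complex.I)) +
        (|u (r * Complex.exp (θ * Complex.I))| *
          logPlus |u (r * Complex.exp (θ * Complex.I))| + 4 / 3) := hψ3.add hlog43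
    have hmono := intervalIntegral.integral_mono (μ := MeasureTheory.volume)
      (by positivity : (0 : ℝ) ≤ 2 * π) (hvc.abs.intervalIntegrable _ _)
      (hsumc.intervalIntegrable _ _) hpt
    rw [intervalIntegral.integral_add (hψ3.intervalIntegrable _ _)
        (hlog43.intervalIntegrable _ _),
      intervalIntegral.integral_add (hlogc.intervalIntegrable _ _) intervalIntegrable_const,
      intervalIntegral.integral_const_mul, intervalIntegral.integral_const, sub_zero,
      smul_eq_mul] at hmono
    exact hmono.trans (by rw [zygmundIntegral]; linarith)
  have he : 5 / 2 ≤ Real.exp 1 := by linarith [Real.exp_one_gt_d9]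
  have hscaled := mul_le_mul_of_nonneg_left hint (by positivity : (0 : ℝ) ≤ 1 / (2 * π))
  have hexpand : 1 / (2 * π) * (3 * (2 * π * ψ 0) + (zygmundIntegral u r + 2 * π * (4 / 3))) =
      3 * ψ 0 + (1 / (2 * π) * zygmundIntegral u r + 4 / 3) := by
    field_simp
  simp only [circleMeanR, Real.rpow_one, div_one]
  linarith

/-- Zygmund's theorem: if `u ∈ h·log⁺h`, then its conjugate `v ∈ h¹`, with
`M₁(r,v) ≤ (1/2π) ∫ |u| log⁺|u| dθ + 3e`. -/
theorem zygmund_classical (u v : ℂ → ℝ) (F : ℂ → ℂ)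
    (hF : DifferentiableOn ℂ F unitDisk)
    (hre : ∀ z ∈ unitDisk, (F z).re = u z)
    (him : ∀ z ∈ unitDisk, (F z).im = v z)
    (hv0 : v 0 = 0)
    (huZ : InZygmundClass u) :
    InHardyR 1 v ∧
      ∀ r : ℝ, 0 < r → r < 1 →
        circleMeanR 1 v r ≤ (1 / (2 * π)) * zygmundIntegral u r + 3 * Real.exp 1 := by
  have hbound : ∀ r : ℝ, 0 < r → r < 1 →
      circleMeanR 1 v r ≤ (1 / (2 * π)) * zygmundIntegral u r + 3 * Real.exp 1 :=
    fun r hr0 hr => circleMeanR_conj_le u v F hF hre him hv0 hr0 hr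
  obtain ⟨C, hC⟩ := huZ
  refine ⟨⟨(1 / (2 * π)) * C + 3 * Real.exp 1, fun r hr0 hr => (hbound r hr0 hr).trans ?_⟩, hbound⟩
  have := hC r hr0 hr
  gcongr
end
end

section
/- (Liu–Zhu) Let f = u + iv be a harmonic K-quasiregular mapping in the unit disk 𝔻 such that u ≥ 0 on 𝔻 and v(0) = 0. If u ∈ h^p for some p ∈ (1,2], then v ∈ h^p, and there is a constant C(K,p), depending only on K and p, such that M_p(r,v) ≤ C(K,p) · M_p(r,u) for all 0 < r < 1. -/
open Complex Real Set

noncomputable section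

section Auxiliary

open Filter Topology MeasureTheory

/-- Differentiation under the integral sign for a jointly continuous integrand. -/
lemma hasDerivAt_intervalIntegral_of_continuousOn_s19 {F F' : ℝ → ℝ → ℝ} {U : Set ℝ} (hU : IsOpen U)
    (hF : ContinuousOn (Function.uncurry F) (U ×ˢ univ))
    (hF' : ContinuousOn (Function.uncurry F') (U ×ˢ univ))
    (hd : ∀ x ∈ U, ∀ t, HasDerivAt (fun y => F y t) (F' x t) x) {x₀ : ℝ} (hx₀ : x₀ ∈ U)
    (a b : ℝ) :
    HasDerivAt (fun x => ∫ t in a..b, F x t) (∫ t in a..b, F' x₀ t) x₀ := by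
  obtain ⟨δ, hδ, hball⟩ := Metric.nhds_basis_closedBall.mem_iff.1 (hU.mem_nhds hx₀)
  have hslice : ∀ {H : ℝ → ℝ → ℝ}, ContinuousOn (Function.uncurry H) (U ×ˢ univ) →
      ∀ x ∈ U, Continuous (H x) := fun hH x hx =>
    hH.comp_continuous (f := fun t => (x, t)) (by fun_prop) fun t => ⟨hx, mem_univ t⟩
  have hK : IsCompact (Metric.closedBall x₀ δ ×ˢ uIcc a b) :=
    (isCompact_closedBall x₀ δ).prod isCompact_uIcc
  obtain ⟨M, hM⟩ := hK.exists_bound_of_continuousOn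
    (hF'.mono (prod_mono hball (subset_univ _)))
  refine (intervalIntegral.hasDerivAt_integral_of_dominated_loc_of_deriv_le
    (bound := fun _ => M) (Metric.closedBall_mem_nhds x₀ hδ) ?_ ?_ ?_ ?_ ?_ ?_).2
  · filter_upwards [hU.mem_nhds hx₀] with x hx
    exact (hslice hF x hx).aestronglyMeasurable
  · exact (hslice hF x₀ hx₀).intervalIntegrable _ _
  · exact (hslice hF' x₀ hx₀).aestronglyMeasurable
  · exact Eventually.of_forall fun t ht x hx => hM (x, t) ⟨hx, uIoc_subset_uIcc ht⟩
  · exact intervalIntegrable_const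
  · exact Eventually.of_forall fun t _ x hx => hd x (hball hx) t

/-- A convex function on a left half-line is bounded below by its limit at `-∞`. -/
lemma ConvexOn.le_of_tendsto_atBot {f : ℝ → ℝ} {b L x : ℝ} (hf : ConvexOn ℝ (Iio b) f)
    (hL : Tendsto f atBot (𝓝 L)) (hx : x < b) : L ≤ f x := by
  by_contra! hlt
  obtain ⟨c, hc1, hc2⟩ := exists_between hlt
  have h1 : ∀ᶠ z in atBot, c < f z := hL.eventually_const_lt hc2
  obtain ⟨y, hy, hyx⟩ := (h1.and (eventually_lt_atBot x)).exists
  set s := (f x - f y) / (x - y) with hs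
  have hs0 : s < 0 := div_neg_of_neg_of_pos (by linarith) (by linarith)
  have h2 : ∀ᶠ z in atBot, f z < L + 1 := hL.eventually_lt_const (by linarith)
  obtain ⟨z, ⟨hz, hzy⟩, hz'⟩ := ((h2.and (eventually_lt_atBot y)).and
    (eventually_lt_atBot (y - (L + 1 - f y) / (-s)))).exists
  have h3 := hf.slope_mono_adjacent (x := z) (y := y) (z := x)
    (show z < b by linarith) hx hzy hyx
  rw [← hs, div_le_iff₀ (by linarith)] at h3
  have h4 : (L + 1 - f y) / (-s) < y - z := by linarith
  rw [div_lt_iff₀ (by linarith)] at h4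
  nlinarith

/-- If the sum of the second derivatives in the directions `1` and `I` is nonnegative on the left
half-plane, the integrals over vertical periods form a convex function. -/
lemma convexOn_integral_of_laplacian_nonneg {ψ : ℂ → ℝ} {D D₂ : ℂ → ℂ → ℝ} {T : ℝ}
    (hT : 0 ≤ T)
    (hψ : ContinuousOn ψ {w | w.re < 0}) (hD : ∀ d, ContinuousOn (D d) {w | w.re < 0})
    (hD₂ : ∀ d, ContinuousOn (D₂ d) {w | w.re < 0})
    (h1 : ∀ (d w : ℂ) (s : ℝ), (w + s * d).re < 0 →
      HasDerivAt (fun s : ℝ => ψ (w + s * d)) (D d (w + s * d)) s)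
    (h2 : ∀ (d w : ℂ) (s : ℝ), (w + s * d).re < 0 →
      HasDerivAt (fun s : ℝ => D d (w + s * d)) (D₂ d (w + s * d)) s)
    (hper : ∀ t : ℝ, t < 0 → D I (t + T * I) = D I t)
    (hpos : ∀ w : ℂ, w.re < 0 → 0 ≤ D₂ 1 w + D₂ I w) :
    ConvexOn ℝ (Iio 0) (fun t : ℝ => ∫ θ in (0:ℝ)..T, ψ (t + θ * I)) := by
  have hcont : ∀ {H : ℂ → ℝ}, ContinuousOn H {w | w.re < 0} →
      ContinuousOn (Function.uncurry fun t θ : ℝ => H (t + θ * I)) (Iio 0 ×ˢ univ) := by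
    intro H hH
    refine hH.comp (f := fun x : ℝ × ℝ => (x.1 : ℂ) + x.2 * I) (by fun_prop) ?_
    rintro ⟨t, θ⟩ ⟨ht, -⟩
    simpa using ht
  have hslice : ∀ {H : ℂ → ℝ}, ContinuousOn H {w | w.re < 0} → ∀ t : ℝ, t < 0 →
      Continuous fun θ : ℝ => H (t + θ * I) := fun hH t ht =>
    hH.comp_continuous (by fun_prop) fun θ => by simpa using ht
  have hm1 : ∀ t ∈ Iio (0:ℝ), HasDerivAt (fun t : ℝ => ∫ θ in (0:ℝ)..T, ψ (t + θ * I))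
      (∫ θ in (0:ℝ)..T, D 1 (t + θ * I)) t := fun t ht =>
    hasDerivAt_intervalIntegral_of_continuousOn_s19 isOpen_Iio (hcont hψ) (hcont (hD 1))
      (fun x hx θ => by
        have := h1 1 (θ * I) x (by simpa using hx)
        simpa [add_comm] using this) ht 0 T
  have hm2 : ∀ t ∈ Iio (0:ℝ), HasDerivAt (fun t : ℝ => ∫ θ in (0:ℝ)..T, D 1 (t + θ * I))
      (∫ θ in (0:ℝ)..T, D₂ 1 (t + θ * I)) t := fun t ht =>
    hasDerivAt_intervalIntegral_of_continuousOn_s19 isOpen_Iio (hcont (hD 1)) (hcont (hD₂ 1))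
      (fun x hx θ => by
        have := h2 1 (θ * I) x (by simpa using hx)
        simpa [add_comm] using this) ht 0 T
  refine convexOn_of_hasDerivWithinAt2_nonneg (convex_Iio 0)
    (fun t ht => (hm1 t ht).continuousAt.continuousWithinAt)
    (f' := fun t : ℝ => ∫ θ in (0:ℝ)..T, D 1 (t + θ * I))
    (f'' := fun t : ℝ => ∫ θ in (0:ℝ)..T, D₂ 1 (t + θ * I))
    (fun t ht => (hm1 t (interior_subset ht)).hasDerivWithinAt)
    (fun t ht => (hm2 t (interior_subset ht)).hasDerivWithinAt) ?_
  intro t ht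
  have ht : t ∈ Iio (0:ℝ) := interior_subset ht
  rw [mem_Iio] at ht
  have hI : ∫ θ in (0:ℝ)..T, D₂ I (t + θ * I) = 0 := by
    rw [intervalIntegral.integral_eq_sub_of_hasDerivAt
      (fun θ _ => h2 I t θ (by simpa using ht)) ((hslice (hD₂ I) t ht).intervalIntegrable _ _)]
    simp [hper t ht]
  have hsum : (∫ θ in (0:ℝ)..T, D₂ 1 (t + θ * I)) =
      ∫ θ in (0:ℝ)..T, (D₂ 1 (t + θ * I) + D₂ I (t + θ * I)) := by
    rw [intervalIntegral.integral_add ((hslice (hD₂ 1) t ht).intervalIntegrable _ _)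
      ((hslice (hD₂ I) t ht).intervalIntegrable _ _), hI, add_zero]
  rw [hsum]
  exact intervalIntegral.integral_nonneg hT fun θ _ => hpos _ (by simpa using ht)

/-- A continuous function on the unit disk whose logarithmic circle integrals are convex satisfies
the sub-mean value inequality at the centre. -/
lemma le_circle_integral_of_convexOn {φ : ℂ → ℝ} (hφ : ContinuousOn φ (Metric.ball 0 1))
    (hconv : ConvexOn ℝ (Iio 0)
      (fun t : ℝ => ∫ θ in (0:ℝ)..(2 * π), φ (Complex.exp (t + θ * I))))
    {r : ℝ} (hr0 : 0 < r) (hr1 : r < 1) :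
    2 * π * φ 0 ≤ ∫ θ in (0:ℝ)..(2 * π), φ (r * Complex.exp (θ * I)) := by
  have hmem : ∀ (x θ : ℝ), |x| < 1 → (x * Complex.exp (θ * I) : ℂ) ∈ Metric.ball (0:ℂ) 1 := by
    intro x θ hx
    simpa [Complex.norm_exp_ofReal_mul_I] using hx
  have hc : Continuous fun x : Metric.ball (0:ℝ) 1 =>
      ∫ θ in (0:ℝ)..(2 * π), φ ((x : ℝ) * Complex.exp (θ * I)) := by
    refine intervalIntegral.continuous_parametric_intervalIntegral_of_continuous' ?_ _ _
    exact hφ.comp_continuous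
      (f := fun q : Metric.ball (0:ℝ) 1 × ℝ => ((q.1 : ℝ) * Complex.exp (q.2 * I) : ℂ))
      (by fun_prop) fun q => hmem _ _ (mem_ball_zero_iff.1 q.1.2)
  have hc' : ContinuousOn (fun x : ℝ => ∫ θ in (0:ℝ)..(2 * π), φ (x * Complex.exp (θ * I)))
      (Metric.ball 0 1) := continuousOn_iff_continuous_domRestrict.2 hc
  have h0 := (hc'.continuousAt (Metric.ball_mem_nhds 0 one_pos)).tendsto.comp
    Real.tendsto_exp_atBot
  have hfun : (fun t : ℝ => ∫ θ in (0:ℝ)..(2 * π), φ (Complex.exp (t + θ * I))) =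
      (fun x : ℝ => ∫ θ in (0:ℝ)..(2 * π), φ (x * Complex.exp (θ * I))) ∘ Real.exp := by
    funext t
    simp [Complex.exp_add]
  rw [← hfun] at h0
  have := hconv.le_of_tendsto_atBot h0 (Real.log_neg hr0 hr1)
  have hlog : Complex.exp (Real.log r : ℂ) = r := by
    rw [← Complex.ofReal_exp, Real.exp_log hr0]
  simpa [Complex.exp_add, hlog] using this

lemma hasDerivAt_const_mul_rpow_sub {a b : ℝ → ℝ} {a₁ b₁ c p x : ℝ} (ha : HasDerivAt a a₁ x)
    (hb : HasDerivAt b b₁ x) (hpos : 0 < a x) :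
    HasDerivAt (fun x => c * a x ^ p - (a x ^ 2 + b x ^ 2) ^ (p / 2))
      (c * p * a x ^ (p - 1) * a₁ -
        p * (a x ^ 2 + b x ^ 2) ^ (p / 2 - 1) * (a x * a₁ + b x * b₁)) x := by
  have hR : 0 < a x ^ 2 + b x ^ 2 := by positivity
  have h := ((ha.rpow_const (p := p) (Or.inl hpos.ne')).const_mul c).sub
    (((ha.pow 2).add (hb.pow 2)).rpow_const (p := p / 2) (Or.inl hR.ne'))
  refine h.congr_deriv ?_
  simp
  ring

lemma hasDerivAt_rpow_mul_sub {a b α β : ℝ → ℝ} {a₂ b₂ c p x : ℝ} (ha : HasDerivAt a (α x) x)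
    (hb : HasDerivAt b (β x) x) (hα : HasDerivAt α a₂ x) (hβ : HasDerivAt β b₂ x)
    (hpos : 0 < a x) :
    HasDerivAt (fun x => c * p * a x ^ (p - 1) * α x -
        p * (a x ^ 2 + b x ^ 2) ^ (p / 2 - 1) * (a x * α x + b x * β x))
      (c * p * ((p - 1) * a x ^ (p - 2) * α x ^ 2 + a x ^ (p - 1) * a₂) -
        p * ((p - 2) * (a x ^ 2 + b x ^ 2) ^ (p / 2 - 2) * (a x * α x + b x * β x) ^ 2 +
          (a x ^ 2 + b x ^ 2) ^ (p / 2 - 1) *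
            (α x ^ 2 + β x ^ 2 + a x * a₂ + b x * b₂))) x := by
  have hR : 0 < a x ^ 2 + b x ^ 2 := by positivity
  have h := (((ha.rpow_const (p := p - 1) (Or.inl hpos.ne')).const_mul (c * p)).mul hα).sub
    (((((ha.pow 2).add (hb.pow 2)).rpow_const (p := p / 2 - 1) (Or.inl hR.ne')).const_mul p).mul
      ((ha.mul hα).add (hb.mul hβ)))
  refine h.congr_deriv ?_
  simp only [Pi.add_apply, Pi.pow_apply, Pi.mul_apply, show p - 1 - 1 = p - 2 by ring,
    show p / 2 - 1 - 1 = p / 2 - 2 by ring]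
  push_cast
  ring

lemma HasDerivAt.comp_line {H : ℂ → ℂ} {H' w d : ℂ} {s : ℝ} (hH : HasDerivAt H H' (w + s * d)) :
    HasDerivAt (fun s : ℝ => H (w + s * d)) (d * H') s := by
  have hγ : HasDerivAt (fun s : ℝ => w + s * d) d s := by
    simpa using ((Complex.ofRealCLM.hasDerivAt (x := s)).mul_const d).const_add w
  exact (hH.comp s hγ).congr_deriv (mul_comm _ _)

lemma HasDerivAt.re_curve {γ : ℝ → ℂ} {γ' : ℂ} {s : ℝ} (h : HasDerivAt γ γ' s) :
    HasDerivAt (fun s => (γ s).re) γ'.re s :=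
  Complex.reCLM.hasFDerivAt.comp_hasDerivAt s h

lemma HasDerivAt.im_curve {γ : ℝ → ℂ} {γ' : ℂ} {s : ℝ} (h : HasDerivAt γ γ' s) :
    HasDerivAt (fun s => (γ s).im) γ'.im s :=
  Complex.imCLM.hasFDerivAt.comp_hasDerivAt s h

/-- The quadratic form inequality expressing that `c u ^ p - |u + i v| ^ p` is subharmonic, where
`P` and `Q` stand for `|∇ u|²` and `|∇ v|²`, and `S` for `|u ∇ u + v ∇ v|²`. -/
lemma laplacian_rpow_nonneg {K p u v P Q S : ℝ} (hp1 : 1 < p) (hp2 : p ≤ 2) (hu : 0 < u)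
    (hP : 0 ≤ P) (hS : 0 ≤ S) (hQ : Q ≤ K ^ 2 * P) :
    0 ≤ (1 + K ^ 2) / (p - 1) * p * ((p - 1) * u ^ (p - 2) * P) -
      p * ((p - 2) * (u ^ 2 + v ^ 2) ^ (p / 2 - 2) * S +
        (u ^ 2 + v ^ 2) ^ (p / 2 - 1) * (P + Q)) := by
  have hle : (u ^ 2 + v ^ 2) ^ (p / 2 - 1) ≤ u ^ (p - 2) := by
    have h1 : (u ^ 2) ^ (p / 2 - 1) = u ^ (p - 2) := by
      rw [← Real.rpow_natCast u 2, ← Real.rpow_mul hu.le]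
      congr 1
      push_cast
      ring
    rw [← h1]
    exact Real.rpow_le_rpow_of_nonpos (by positivity) (by nlinarith [sq_nonneg v]) (by linarith)
  have hR : 0 ≤ (u ^ 2 + v ^ 2) ^ (p / 2 - 1) := by positivity
  have hS' : (p - 2) * (u ^ 2 + v ^ 2) ^ (p / 2 - 2) * S ≤ 0 :=
    mul_nonpos_of_nonpos_of_nonneg
      (mul_nonpos_of_nonpos_of_nonneg (by linarith) (by positivity)) hS
  have hmain : (u ^ 2 + v ^ 2) ^ (p / 2 - 1) * (P + Q) ≤ u ^ (p - 2) * ((1 + K ^ 2) * P) :=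
    (mul_le_mul_of_nonneg_left (by linarith) hR).trans
      (mul_le_mul_of_nonneg_right hle (by positivity))
  have hc : (1 + K ^ 2) / (p - 1) * p * ((p - 1) * u ^ (p - 2) * P) =
      p * (u ^ (p - 2) * ((1 + K ^ 2) * P)) := by
    have : p - 1 ≠ 0 := by linarith
    field_simp
  rw [hc, ← mul_sub]
  exact mul_nonneg (by linarith) (by linarith)

lemma convexOn_integral_rpow_sub {A B : ℂ → ℂ} {K p : ℝ} (hp1 : 1 < p) (hp2 : p ≤ 2)
    (hA : DifferentiableOn ℂ A {w | w.re < 0}) (hB : DifferentiableOn ℂ B {w | w.re < 0})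
    (hAper : Function.Periodic A (2 * π * I)) (hBper : Function.Periodic B (2 * π * I))
    (hpos : ∀ w : ℂ, w.re < 0 → 0 < (A w).re)
    (hAB : ∀ w : ℂ, w.re < 0 → ‖deriv B w‖ ≤ K * ‖deriv A w‖) :
    ConvexOn ℝ (Iio 0) (fun t : ℝ => ∫ θ in (0:ℝ)..(2 * π),
      ((1 + K ^ 2) / (p - 1) * (A (t + θ * I)).re ^ p -
        ((A (t + θ * I)).re ^ 2 + (B (t + θ * I)).im ^ 2) ^ (p / 2))) := by
  set U : Set ℂ := {w | w.re < 0} with hU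
  have hUo : IsOpen U := isOpen_lt Complex.continuous_re continuous_const
  have hA' := hA.deriv hUo
  have hB' := hB.deriv hUo
  have hder : ∀ {H : ℂ → ℂ}, DifferentiableOn ℂ H U → ∀ z ∈ U, HasDerivAt H (deriv H z) z :=
    fun hH z hz => (hH.differentiableAt (hUo.mem_nhds hz)).hasDerivAt
  have hperD : ∀ {H : ℂ → ℂ}, Function.Periodic H (2 * π * I) →
      Function.Periodic (deriv H) (2 * π * I) := fun {H} hH w => by
    rw [← deriv_comp_add_const, show (fun x => H (x + 2 * π * I)) = H from funext hH]
  set c := (1 + K ^ 2) / (p - 1) with hc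
  have cA := hA.continuousOn
  have cB := hB.continuousOn
  have cA' := hA'.continuousOn
  have cB' := hB'.continuousOn
  have cA'' := (hA'.deriv hUo).continuousOn
  have cB'' := (hB'.deriv hUo).continuousOn
  have re_cont : ∀ {H : ℂ → ℂ}, ContinuousOn H U → ContinuousOn (fun w => (H w).re) U :=
    fun hH => Complex.continuous_re.comp_continuousOn hH
  have im_cont : ∀ {H : ℂ → ℂ}, ContinuousOn H U → ContinuousOn (fun w => (H w).im) U :=
    fun hH => Complex.continuous_im.comp_continuousOn hH
  have cu : ∀ q : ℝ, ContinuousOn (fun w => (A w).re ^ q) U := fun q =>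
    (re_cont cA).rpow_const fun w hw => Or.inl (hpos w hw).ne'
  have cR : ∀ q : ℝ, ContinuousOn (fun w => ((A w).re ^ 2 + (B w).im ^ 2) ^ q) U := fun q =>
    (((re_cont cA).pow 2).add ((im_cont cB).pow 2)).rpow_const fun w hw => 
      Or.inl (add_pos_of_pos_of_nonneg (pow_pos (hpos w hw) 2) (sq_nonneg _)).ne'
  have c1 : ∀ d : ℂ, ContinuousOn (fun w => (d * deriv A w).re) U := fun d =>
    re_cont (continuousOn_const.mul cA')
  have c2 : ∀ d : ℂ, ContinuousOn (fun w => (d * deriv B w).im) U := fun d =>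
    im_cont (continuousOn_const.mul cB')
  have c3 : ∀ d : ℂ, ContinuousOn (fun w => (d * (d * deriv (deriv A) w)).re) U := fun d =>
    re_cont (continuousOn_const.mul (continuousOn_const.mul cA''))
  have c4 : ∀ d : ℂ, ContinuousOn (fun w => (d * (d * deriv (deriv B) w)).im) U := fun d =>
    im_cont (continuousOn_const.mul (continuousOn_const.mul cB''))
  have c5 := re_cont cA
  have c6 := im_cont cB
  refine convexOn_integral_of_laplacian_nonneg (by positivity)
    (ψ := fun w => c * (A w).re ^ p - ((A w).re ^ 2 + (B w).im ^ 2) ^ (p / 2))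
    (D := fun d w => c * p * (A w).re ^ (p - 1) * (d * deriv A w).re -
        p * ((A w).re ^ 2 + (B w).im ^ 2) ^ (p / 2 - 1) *
          ((A w).re * (d * deriv A w).re + (B w).im * (d * deriv B w).im))
    (D₂ := fun d w => c * p * ((p - 1) * (A w).re ^ (p - 2) * (d * deriv A w).re ^ 2 +
          (A w).re ^ (p - 1) * (d * (d * deriv (deriv A) w)).re) -
        p * ((p - 2) * ((A w).re ^ 2 + (B w).im ^ 2) ^ (p / 2 - 2) *
            ((A w).re * (d * deriv A w).re + (B w).im * (d * deriv B w).im) ^ 2 +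
          ((A w).re ^ 2 + (B w).im ^ 2) ^ (p / 2 - 1) *
            ((d * deriv A w).re ^ 2 + (d * deriv B w).im ^ 2 +
              (A w).re * (d * (d * deriv (deriv A) w)).re +
              (B w).im * (d * (d * deriv (deriv B) w)).im)))
    ?_ ?_ ?_ ?_ ?_ ?_ ?_
  · exact (continuousOn_const.mul (cu p)).sub (cR _)
  · intro d
    have := c1 d
    have := c2 d
    have := cu (p - 1)
    have := cR (p / 2 - 1)
    fun_prop
  · intro d
    have := c1 d
    have := c2 d
    have := c3 d
    have := c4 d
    have := cu (p - 1)
    have := cu (p - 2)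
    have := cR (p / 2 - 1)
    have := cR (p / 2 - 2)
    fun_prop
  · intro d w s hs
    exact hasDerivAt_const_mul_rpow_sub (hder hA _ hs).comp_line.re_curve
      (hder hB _ hs).comp_line.im_curve (hpos _ hs)
  · intro d w s hs
    exact hasDerivAt_rpow_mul_sub (hder hA _ hs).comp_line.re_curve
      (hder hB _ hs).comp_line.im_curve
      ((hder hA' _ hs).comp_line.const_mul d).re_curve
      ((hder hB' _ hs).comp_line.const_mul d).im_curve (hpos _ hs)
  · intro t _
    push_cast
    simp only [hAper _, hBper _, hperD hAper _, hperD hBper _]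
  · intro w hw
    have hQ : (deriv B w).re ^ 2 + (deriv B w).im ^ 2 ≤
        K ^ 2 * ((deriv A w).re ^ 2 + (deriv A w).im ^ 2) := by
      have h1 : ‖deriv B w‖ ^ 2 ≤ (K * ‖deriv A w‖) ^ 2 :=
        pow_le_pow_left₀ (norm_nonneg _) (hAB w hw) 2
      rw [mul_pow, Complex.sq_norm, Complex.sq_norm, Complex.normSq_apply,
        Complex.normSq_apply] at h1
      linarith
    have h := laplacian_rpow_nonneg (v := (B w).im)
      (S := ((A w).re * (deriv A w).re + (B w).im * (deriv B w).im) ^ 2 +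
        (-((A w).re * (deriv A w).im) + (B w).im * (deriv B w).re) ^ 2) hp1 hp2 (hpos w hw)
      (by positivity) (by positivity) hQ
    simp only [one_mul, ← mul_assoc, Complex.I_mul_I, neg_one_mul, Complex.neg_re, Complex.neg_im,
      Complex.I_mul_re, Complex.I_mul_im]
    refine h.trans_eq ?_
    ring

/-- Riesz's inequality for holomorphic functions `F`, `G` with `Re F > 0` and `|G'| ≤ K |F'|`. -/
lemma integral_rpow_abs_im_le {F G : ℂ → ℂ} {K p r : ℝ} (hp1 : 1 < p) (hp2 : p ≤ 2)
    (hF : DifferentiableOn ℂ F (Metric.ball 0 1)) (hG : DifferentiableOn ℂ G (Metric.ball 0 1))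
    (hpos : ∀ z ∈ Metric.ball (0:ℂ) 1, 0 < (F z).re) (hG0 : (G 0).im = 0)
    (hFG : ∀ z ∈ Metric.ball (0:ℂ) 1, ‖deriv G z‖ ≤ K * ‖deriv F z‖)
    (hr0 : 0 < r) (hr1 : r < 1) :
    ∫ θ in (0:ℝ)..(2 * π), |(G (r * Complex.exp (θ * I))).im| ^ p ≤
      (1 + K ^ 2) / (p - 1) *
        ∫ θ in (0:ℝ)..(2 * π), |(F (r * Complex.exp (θ * I))).re| ^ p := by
  have hexp : ∀ w : ℂ, w.re < 0 → Complex.exp w ∈ Metric.ball (0:ℂ) 1 := by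
    intro w hw
    simpa [Complex.norm_exp] using hw
  have hdiff : ∀ {H : ℂ → ℂ}, DifferentiableOn ℂ H (Metric.ball 0 1) →
      DifferentiableOn ℂ (fun w => H (Complex.exp w)) {w | w.re < 0} := fun hH =>
    hH.comp Complex.differentiable_exp.differentiableOn fun w hw => hexp w hw
  have hderiv : ∀ {H : ℂ → ℂ}, DifferentiableOn ℂ H (Metric.ball 0 1) → ∀ w : ℂ, w.re < 0 →
      deriv (fun w => H (Complex.exp w)) w = deriv H (Complex.exp w) * Complex.exp w :=
    fun hH w hw => ((hH.differentiableAt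
      (Metric.isOpen_ball.mem_nhds (hexp w hw))).hasDerivAt.comp w
        (Complex.hasDerivAt_exp w)).deriv
  set c := (1 + K ^ 2) / (p - 1) with hc
  have hc1 : 1 ≤ c := by
    rw [hc, le_div_iff₀ (by linarith)]
    nlinarith [sq_nonneg K]
  have hre : ContinuousOn (fun z => |(F z).re| ^ p) (Metric.ball 0 1) :=
    (Complex.continuous_re.comp_continuousOn hF.continuousOn).abs.rpow_const
      fun _ _ => Or.inr (by linarith)
  have him : ContinuousOn (fun z => |(G z).im| ^ p) (Metric.ball 0 1) :=
    (Complex.continuous_im.comp_continuousOn hG.continuousOn).abs.rpow_const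
      fun _ _ => Or.inr (by linarith)
  have hφ : ContinuousOn
      (fun z => c * (F z).re ^ p - ((F z).re ^ 2 + (G z).im ^ 2) ^ (p / 2))
      (Metric.ball 0 1) := by
    have h1 := Complex.continuous_re.comp_continuousOn hF.continuousOn
    have h2 := Complex.continuous_im.comp_continuousOn hG.continuousOn
    exact (continuousOn_const.mul (h1.rpow_const fun _ _ => Or.inr (by linarith))).sub
      (((h1.pow 2).add (h2.pow 2)).rpow_const fun _ _ => Or.inr (by linarith))
  have hper : ∀ H : ℂ → ℂ, Function.Periodic (fun w => H (Complex.exp w)) (2 * π * I) :=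
    fun H w => by simp only [Complex.exp_periodic w]
  have hconv := (convexOn_integral_rpow_sub hp1 hp2 (hdiff hF) (hdiff hG) (hper F) (hper G)
      (fun w hw => hpos _ (hexp w hw)) fun w hw => by
        rw [hderiv hF w hw, hderiv hG w hw, norm_mul, norm_mul, ← mul_assoc]
        exact mul_le_mul_of_nonneg_right (hFG _ (hexp w hw)) (norm_nonneg _))
  have hmean := le_circle_integral_of_convexOn hφ hconv hr0 hr1
  have hmem : ∀ θ : ℝ, (r * Complex.exp (θ * I) : ℂ) ∈ Metric.ball (0:ℂ) 1 := by
    intro θ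
    simpa [Complex.norm_exp_ofReal_mul_I, abs_of_pos hr0] using hr1
  have hint : ∀ {H : ℂ → ℝ}, ContinuousOn H (Metric.ball 0 1) →
      IntervalIntegrable (fun θ : ℝ => H (r * Complex.exp (θ * I))) volume 0 (2 * π) :=
    fun hH => (hH.comp_continuous (by fun_prop) hmem).intervalIntegrable _ _
  have h0 : 0 ≤ c * (F 0).re ^ p - ((F 0).re ^ 2 + (G 0).im ^ 2) ^ (p / 2) := by
    have hF0 := hpos 0 (Metric.mem_ball_self one_pos)
    have h1 : ((F 0).re ^ 2) ^ (p / 2) = (F 0).re ^ p := by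
      rw [← Real.rpow_natCast (F 0).re 2, ← Real.rpow_mul hF0.le]
      congr 1
      push_cast
      ring
    rw [hG0, zero_pow two_ne_zero, add_zero, h1]
    nlinarith [Real.rpow_pos_of_pos hF0 p]
  have hle := intervalIntegral.integral_mono_on (a := 0) (b := 2 * π) (μ := volume)
    (by positivity) (hint hφ) (hint ((continuousOn_const (c := c)).mul hre |>.sub him))
    fun θ _ => by
      have hu := hpos _ (hmem θ)
      have h1 : |(G (r * Complex.exp (θ * I))).im| ^ p ≤
          ((F (r * Complex.exp (θ * I))).re ^ 2 +
            (G (r * Complex.exp (θ * I))).im ^ 2) ^ (p / 2) := by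
        have h2 : |(G (r * Complex.exp (θ * I))).im| ^ p =
            ((G (r * Complex.exp (θ * I))).im ^ 2) ^ (p / 2) := by
          rw [← sq_abs, ← Real.rpow_natCast |_| 2, ← Real.rpow_mul (abs_nonneg _)]
          congr 1
          push_cast
          ring
        rw [h2]
        exact Real.rpow_le_rpow (by positivity) (by nlinarith) (by linarith)
      simp only [Pi.sub_apply, Pi.mul_apply, abs_of_pos hu]
      linarith
  have hsplit := intervalIntegral.integral_sub ((hint hre).const_mul c) (hint him)
  rw [intervalIntegral.integral_const_mul] at hsplit
  have hpos0 := mul_nonneg (by positivity : (0:ℝ) ≤ 2 * π) h0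
  have := (hpos0.trans hmean).trans (hle.trans_eq hsplit)
  linarith

/-- A holomorphic function on the unit disk with nonnegative real part and nonzero derivative at
the centre has positive real part. -/
lemma re_pos_of_re_nonneg {F : ℂ → ℂ} (hF : DifferentiableOn ℂ F (Metric.ball 0 1))
    (hF0 : deriv F 0 ≠ 0) (hnn : ∀ z ∈ Metric.ball (0:ℂ) 1, 0 ≤ (F z).re) :
    ∀ z ∈ Metric.ball (0:ℂ) 1, 0 < (F z).re := by
  intro z hz
  rcases (hF.analyticOnNhd Metric.isOpen_ball).is_constant_or_isOpen
    (convex_ball 0 1).isPreconnected with ⟨w, hw⟩ | hopen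
  · have hev : F =ᶠ[𝓝 0] fun _ => w := by
      filter_upwards [Metric.ball_mem_nhds (0:ℂ) one_pos] with y hy using hw y hy
    exact absurd (hev.deriv_eq.trans (deriv_const _ _)) hF0
  · obtain ⟨ε, hε, hball⟩ := Metric.isOpen_iff.1 (hopen _ subset_rfl Metric.isOpen_ball) (F z)
      (mem_image_of_mem F hz)
    obtain ⟨y, hy, hyz⟩ := hball (show F z - (ε / 2 : ℝ) ∈ Metric.ball (F z) ε by
      rw [Metric.mem_ball, dist_eq_norm, sub_sub_cancel_left, norm_neg, Complex.norm_real,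
        Real.norm_of_nonneg (by positivity)]
      linarith)
    have h := hnn y hy
    rw [hyz, Complex.sub_re, Complex.ofReal_re] at h
    linarith

/-- If `g'` is dominated by `(K - 1) / (K + 1)` times `h'`, then `h' - g'` is dominated by `K`
times `h' + g'`. -/
lemma norm_sub_le_mul_norm_add {K : ℝ} (hK : 1 ≤ K) {a b : ℂ}
    (hab : ‖b‖ ≤ (K - 1) / (K + 1) * ‖a‖) : ‖a - b‖ ≤ K * ‖a + b‖ := by
  rw [div_mul_eq_mul_div, le_div_iff₀ (by linarith)] at hab
  have h1 := norm_sub_le a b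
  have h2 : ‖a‖ ≤ ‖a + b‖ + ‖b‖ := by simpa using norm_sub_le (a + b) b
  nlinarith

end Auxiliary

/-- The Liu–Zhu theorem: Riesz's theorem for harmonic `K`-quasiregular mappings,
`1 < p ≤ 2`, `u ≥ 0`, with a constant depending only on `K` and `p`. -/
theorem liu_zhu (K p : ℝ) (hK : 1 ≤ K) (hp1 : 1 < p) (hp2 : p ≤ 2) :
    ∃ C : ℝ, ∀ (h g f : ℂ → ℂ) (u v : ℂ → ℝ),
      DifferentiableOn ℂ h unitDisk → DifferentiableOn ℂ g unitDisk →
      g 0 = 0 →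
      (∀ z ∈ unitDisk, f z = h z + (starRingEnd ℂ) (g z)) →
      (∀ z ∈ unitDisk,
        deriv h z ≠ 0 ∧ ‖deriv g z‖ ≤ (K - 1) / (K + 1) * ‖deriv h z‖) →
      (∀ z, u z = (f z).re) → (∀ z, v z = (f z).im) →
      (∀ z ∈ unitDisk, 0 ≤ u z) → v 0 = 0 →
      InHardyR p u →
      InHardyR p v ∧ ∀ r : ℝ, 0 < r → r < 1 → circleMeanR p v r ≤ C * circleMeanR p u r := by
  refine ⟨((1 + K ^ 2) / (p - 1)) ^ (1 / p), ?_⟩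
  intro h g f u v hh hg _ hf hdil hu hv hnn hv0 ⟨Cu, hCu⟩
  have hc : 0 ≤ (1 + K ^ 2) / (p - 1) := div_nonneg (by positivity) (by linarith)
  have h0mem : (0:ℂ) ∈ unitDisk := Metric.mem_ball_self one_pos
  have hdh : ∀ z ∈ unitDisk, DifferentiableAt ℂ h z := fun z hz =>
    hh.differentiableAt (Metric.isOpen_ball.mem_nhds hz)
  have hdg : ∀ z ∈ unitDisk, DifferentiableAt ℂ g z := fun z hz =>
    hg.differentiableAt (Metric.isOpen_ball.mem_nhds hz)
  have hure : ∀ z ∈ unitDisk, u z = ((h + g) z).re := fun z hz => by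
    simp [hu, hf z hz]
  have hvim : ∀ z ∈ unitDisk, v z = ((h - g) z).im := fun z hz => by
    simp [hv, hf z hz, sub_eq_add_neg]
  have hderiv : ∀ z ∈ unitDisk, ‖deriv (h - g) z‖ ≤ K * ‖deriv (h + g) z‖ := by
    intro z hz
    rw [deriv_sub (hdh z hz) (hdg z hz), deriv_add (hdh z hz) (hdg z hz)]
    exact norm_sub_le_mul_norm_add hK (hdil z hz).2
  have hne : deriv (h + g) 0 ≠ 0 := by
    rw [deriv_add (hdh 0 h0mem) (hdg 0 h0mem)]
    intro h0
    have h1 := (hdil 0 h0mem).2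
    have h2 := norm_pos_iff.2 (hdil 0 h0mem).1
    rw [eq_neg_of_add_eq_zero_left h0, norm_neg] at h1 h2
    rw [div_mul_eq_mul_div, le_div_iff₀ (by linarith)] at h1
    nlinarith
  have hpos := re_pos_of_re_nonneg (hh.add hg) hne fun z hz => hure z hz ▸ hnn z hz
  have hmem : ∀ r : ℝ, 0 < r → r < 1 → ∀ θ : ℝ,
      (r * Complex.exp (θ * I) : ℂ) ∈ unitDisk := by
    intro r hr0 hr1 θ
    simpa [unitDisk, Complex.norm_exp_ofReal_mul_I, abs_of_pos hr0] using hr1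
  have key : ∀ r : ℝ, 0 < r → r < 1 → circleMeanR p v r ≤
      ((1 + K ^ 2) / (p - 1)) ^ (1 / p) * circleMeanR p u r := by
    intro r hr0 hr1
    have hmain := integral_rpow_abs_im_le hp1 hp2 (hh.add hg) (hh.sub hg) hpos
      (by rw [← hvim 0 h0mem, hv0]) hderiv hr0 hr1
    simp only [← hvim _ (hmem r hr0 hr1 _), ← hure _ (hmem r hr0 hr1 _)] at hmain
    have hint : ∀ w : ℂ → ℝ,
        0 ≤ ∫ θ in (0:ℝ)..(2 * π), |w (r * Complex.exp (θ * I))| ^ p := fun w =>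
      intervalIntegral.integral_nonneg (by positivity) fun θ _ => by positivity
    unfold circleMeanR
    have hu0 := hint u
    have hv0 := hint v
    rw [← Real.mul_rpow hc (by positivity)]
    refine Real.rpow_le_rpow (by positivity) ?_ (by positivity)
    calc _ ≤ 1 / (2 * π) * ((1 + K ^ 2) / (p - 1) *
          ∫ θ in (0:ℝ)..(2 * π), |u (r * Complex.exp (θ * I))| ^ p) :=
        mul_le_mul_of_nonneg_left hmain (by positivity)
      _ = _ := by ring
  exact ⟨⟨_, fun r hr0 hr1 => (key r hr0 hr1).trans
    (mul_le_mul_of_nonneg_left (hCu r hr0 hr1) (by positivity))⟩, key⟩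
end
end
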